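/- arXiv:1512.04717 — 4 statements merged into one kernel-verified Lean document; each statement's English description precedes it below -/
import Mathlib

section
/- Let X be a connected topological manifold and let x, y ∈ X with x ≠ y. Then there exists an injective continuous curve σ : [0,1] → X with σ(0) = x and σ(1) = y. -/
open Set Function Topology

/-- The concatenation of two injective paths that meet only at the junction is injective. -/
theorem Path.trans_injective {X : Type*} [TopologicalSpace X] {x y z : X} {γ : Path x y}
    {γ' : Path y z} (hγ : Injective γ) (hγ' : Injective γ')
    (h : ∀ s t, γ s = γ' t → γ' t = y) : Injective (γ.trans γ') := by
  have key : ∀ s t, γ s = γ' t → s = 1 ∧ t = 0 := fun s t hst =>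
    ⟨hγ (by rw [hst, h s t hst, γ.target]), hγ' (by rw [h s t hst, γ'.source])⟩
  intro s t hst
  rw [Path.trans_apply, Path.trans_apply] at hst
  split_ifs at hst with hs ht ht
  · have := congrArg Subtype.val (hγ hst)
    exact Subtype.ext (by simpa using this)
  · have := congrArg Subtype.val (key _ _ hst).2
    simp only [Icc.coe_zero] at this
    exact absurd (by linarith) ht
  · have := congrArg Subtype.val (key _ _ hst.symm).2
    simp only [Icc.coe_zero] at this
    exact absurd (by linarith) hs
  · have := congrArg Subtype.val (hγ' hst)
    exact Subtype.ext (by simpa using this)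

theorem Path.subpath_injective {X : Type*} [TopologicalSpace X] {x y : X} {γ : Path x y}
    (hγ : Injective γ) {a b : unitInterval} (hab : a ≠ b) : Injective (γ.subpath a b) := by
  intro s t hst
  have h := congrArg Subtype.val (hγ hst)
  simp only [Icc.coe_convexComb] at h
  have hab' : (b : ℝ) - a ≠ 0 := sub_ne_zero.2 fun h => hab (Subtype.ext h.symm)
  refine Subtype.ext (mul_right_cancel₀ hab' ?_)
  linear_combination h

/-- An injective path from `x` ending in a closed set `K`, cut at its first hitting point of `K`,
can be continued inside `K` to any other point of `K`, provided that distinct points of `K` are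
joined by injective paths in `K`. -/
theorem exists_injective_path_of_mem_closed {X : Type*} [TopologicalSpace X] {K : Set X}
    (hK : IsClosed K)
    (hjoin : ∀ a ∈ K, ∀ b ∈ K, a ≠ b → ∃ σ : Path a b, Injective σ ∧ ∀ t, σ t ∈ K)
    {x z w : X} (σ : Path x z) (hσ : Injective σ) (hz : z ∈ K) (hw : w ∈ K) (hxw : x ≠ w) :
    ∃ τ : Path x w, Injective τ := by
  obtain ⟨t, htK, htle⟩ := (hK.preimage σ.continuous).isCompact.exists_isLeast
    ⟨1, by simpa using hz⟩
  by_cases ht : t = 0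
  · subst ht
    obtain ⟨τ, hτ, -⟩ := hjoin x (by simpa using htK) w hw hxw
    exact ⟨τ, hτ⟩
  have hsub : Injective (σ.subpath 0 t) := Path.subpath_injective hσ (Ne.symm ht)
  by_cases hwt : σ t = w
  · exact ⟨(σ.subpath 0 t).cast σ.source.symm hwt.symm, hsub⟩
  obtain ⟨τ, hτ, hτK⟩ := hjoin (σ t) htK w hw hwt
  refine ⟨((σ.subpath 0 t).trans τ).cast σ.source.symm rfl,
    Path.trans_injective hsub hτ fun s r hsr => ?_⟩
  obtain ⟨u, hu, hus⟩ : σ.subpath 0 t s ∈ σ '' Icc 0 t := by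
    rw [← σ.range_subpath_of_le 0 t unitInterval.nonneg']
    exact mem_range_self s
  have hut : u = t := le_antisymm hu.2 (htle (by simpa [hus, hsr] using hτK r))
  rw [← hsr, ← hus, hut]

/-- In a Hausdorff space, every point in the source of a chart to a proper normed space has a
closed neighbourhood in which distinct points are joined by injective paths. -/
theorem OpenPartialHomeomorph.exists_closed_nhds_injective_path {E X : Type*}
    [NormedAddCommGroup E] [NormedSpace ℝ E] [ProperSpace E] [TopologicalSpace X] [T2Space X]
    (e : OpenPartialHomeomorph X E) {p : X} (hp : p ∈ e.source) :
    ∃ K ∈ 𝓝 p, IsClosed K ∧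
      ∀ a ∈ K, ∀ b ∈ K, a ≠ b → ∃ σ : Path a b, Injective σ ∧ ∀ t, σ t ∈ K := by
  obtain ⟨r, hr, hrt⟩ := Metric.nhds_basis_closedBall.mem_iff.1
    (e.open_target.mem_nhds (e.map_source hp))
  have hcont : ContinuousOn e.symm (Metric.closedBall (e p) r) := e.continuousOn_symm.mono hrt
  refine ⟨e.symm '' Metric.closedBall (e p) r, ?_,
    ((isCompact_closedBall _ _).image_of_continuousOn hcont).isClosed, ?_⟩
  · rw [← e.symm_map_nhds_eq hp]
    exact Filter.image_mem_map (Metric.closedBall_mem_nhds _ hr)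
  · rintro _ ⟨a, ha, rfl⟩ _ ⟨b, hb, rfl⟩ hab
    have hmem : ∀ t, Path.segment a b t ∈ Metric.closedBall (e p) r := fun t =>
      (convex_closedBall (e p) r).segment_subset ha hb
        (by rw [← Path.range_segment]; exact mem_range_self t)
    refine ⟨(Path.segment a b).map' (hcont.mono (range_subset_iff.2 hmem)), fun s t hst => ?_,
      fun t => mem_image_of_mem _ (hmem t)⟩
    have h := e.symm.injOn (hrt (hmem s)) (hrt (hmem t)) hst
    exact Subtype.ext (AffineMap.lineMap_injective ℝ (fun h => hab (congrArg e.symm h)) h)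

/-- Let `X` be a connected topological manifold (a connected, Hausdorff, locally
Euclidean space, i.e. a connected Hausdorff space charted on `ℝⁿ`) and let
`x, y ∈ X` with `x ≠ y`. Then there exists an injective continuous curve
`σ : [0,1] → X` with `σ 0 = x` and `σ 1 = y`. -/
theorem exists_injective_path_of_connected_manifold {n : ℕ} {X : Type*}
    [TopologicalSpace X] [T2Space X] [ChartedSpace (EuclideanSpace ℝ (Fin n)) X]
    [ConnectedSpace X] (x y : X) (hxy : x ≠ y) :
    ∃ σ : Path x y, Function.Injective σ := by
  let S : Set X := {z | x ≠ z → ∃ σ : Path x z, Injective σ}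
  have hS : ∀ p, ∃ K ∈ 𝓝 p, ∀ z ∈ K, z ∈ S → K ⊆ S := by
    intro p
    obtain ⟨K, hKp, hK, hjoin⟩ :=
      (chartAt (EuclideanSpace ℝ (Fin n)) p).exists_closed_nhds_injective_path
        (mem_chart_source _ p)
    refine ⟨K, hKp, fun z hz hzS w hw hxw => ?_⟩
    by_cases hxz : x = z
    · subst hxz
      obtain ⟨σ, hσ, -⟩ := hjoin x hz w hw hxw
      exact ⟨σ, hσ⟩
    · obtain ⟨σ, hσ⟩ := hzS hxz
      exact exists_injective_path_of_mem_closed hK hjoin σ hσ hz hw hxw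
  have hclopen : IsClopen S := by
    refine ⟨isOpen_compl_iff.1 (isOpen_iff_mem_nhds.2 fun p hp => ?_),
      isOpen_iff_mem_nhds.2 fun p hp => ?_⟩ <;> obtain ⟨K, hKp, hK⟩ := hS p
    · exact Filter.mem_of_superset hKp fun z hz hzS => hp (hK z hz hzS (mem_of_mem_nhds hKp))
    · exact Filter.mem_of_superset hKp (hK p (mem_of_mem_nhds hKp) hp)
  have huniv : S = univ := hclopen.eq_univ ⟨x, fun h => absurd rfl h⟩
  exact (huniv ▸ mem_univ y : y ∈ S) hxy
end

section
/- Let A ⊆ ℂ be open, connected, and not simply connected. Then there exists a simple closed curve in A which is not null-homotopic in A; that is, there exists a continuous loop γ : [0,1] → A with γ(0) = γ(1) that is injective on [0,1) and is not homotopic in A (relative to its base point, or freely) to a constant loop. -/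
open Set Path
open scoped unitInterval Topology

/-- The concatenation of two injective paths that meet only in endpoints takes no value twice,
except possibly at the two ends of the unit interval. -/
theorem Path.eq_or_eq_of_trans_apply_eq {X : Type*} [TopologicalSpace X] {x y z : X}
    {p : Path x y} {q : Path y z} (hp : Function.Injective p) (hq : Function.Injective q)
    (hpq : ∀ s t, p s = q t → s = 1 ∧ t = 0 ∨ s = 0 ∧ t = 1) {s t : I} (hst : s ≤ t)
    (h : p.trans q s = p.trans q t) : s = t ∨ s = 0 ∧ t = 1 := by
  have hst' : (s : ℝ) ≤ t := hst
  rw [Path.trans_apply, Path.trans_apply] at h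
  split_ifs at h with hs ht ht
  · have := congrArg Subtype.val (hp h)
    exact .inl (Subtype.ext (by simpa using this))
  · rcases hpq _ _ h with ⟨h₁, h₂⟩ | ⟨h₁, h₂⟩ <;> rw [Subtype.ext_iff] at h₁ h₂ <;>
      simp only [Icc.coe_one, Icc.coe_zero] at h₁ h₂
    · exact .inl (Subtype.ext (by linarith))
    · exact .inr ⟨Subtype.ext (by simp only [Icc.coe_zero]; linarith),
        Subtype.ext (by simp only [Icc.coe_one]; linarith)⟩
  · linarith
  · have := congrArg Subtype.val (hq h)
    exact .inl (Subtype.ext (by simp only at this; linarith))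

section PolygonalChains

variable {E : Type*} [NormedAddCommGroup E] [NormedSpace ℝ E] {A : Set E}

/-- Two paths in `A` with the same endpoints that stay in a convex subset of `A` are homotopic. -/
theorem Path.homotopic_of_mem_convex {x y : A} (p q : Path x y) {C : Set E} (hC : Convex ℝ C)
    (hCA : C ⊆ A) (hp : ∀ t, (p t : E) ∈ C) (hq : ∀ t, (q t : E) ∈ C) : p.Homotopic q :=
  ⟨{ toFun := fun s => ⟨AffineMap.lineMap (p s.2 : E) (q s.2 : E) (s.1 : ℝ),
        hCA (hC.lineMap_mem (hp _) (hq _) s.1.2)⟩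
     continuous_toFun := by
       refine Continuous.subtype_mk ?_ _
       simp only [AffineMap.lineMap_apply_module]
       fun_prop
     map_zero_left := fun t => by ext; simp
     map_one_left := fun t => by ext; simp
     prop' := by
       rintro s t (rfl | rfl) <;> ext <;> simp }⟩

/-- The straight path between two points of `A` whose segment is contained in `A`. -/
noncomputable def segmentPath {x y : A} (h : segment ℝ (x : E) y ⊆ A) : Path x y where
  toFun t := ⟨Path.segment (x : E) y t, h (Path.range_segment (x : E) y ▸ mem_range_self t)⟩
  continuous_toFun := Continuous.subtype_mk (map_continuous _) _
  source' := by ext; simp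
  target' := by ext; simp

theorem segmentPath_mem {x y : A} (h : segment ℝ (x : E) y ⊆ A) (t : I) :
    (segmentPath h t : E) ∈ segment ℝ (x : E) y :=
  Path.range_segment (x : E) y ▸ mem_range_self t

theorem segmentPath_injective {x y : A} (h : segment ℝ (x : E) y ⊆ A) (hne : x ≠ y) :
    Function.Injective (segmentPath h) := fun _ _ hst =>
  Path.segment_injective_of_ne (Subtype.coe_injective.ne hne) (congrArg Subtype.val hst)

/-- The homotopy class of a straight path. -/
noncomputable def segmentClass {x y : A} (h : segment ℝ (x : E) y ⊆ A) :
    Homotopic.Quotient x y :=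
  Homotopic.Quotient.mk (segmentPath h)

theorem segmentClass_trans {x y z : A} {C : Set E} (hC : Convex ℝ C) (hCA : C ⊆ A)
    (hx : (x : E) ∈ C) (hy : (y : E) ∈ C) (hz : (z : E) ∈ C)
    (hxy : segment ℝ (x : E) y ⊆ A) (hyz : segment ℝ (y : E) z ⊆ A)
    (hxz : segment ℝ (x : E) z ⊆ A) :
    (segmentClass hxy).trans (segmentClass hyz) = segmentClass hxz := by
  rw [segmentClass, segmentClass, ← Homotopic.Quotient.mk_trans]
  refine Homotopic.Quotient.eq.2 (Path.homotopic_of_mem_convex _ _ hC hCA (fun t => ?_)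
    fun t => hC.segment_subset hx hz (segmentPath_mem _ _))
  rw [Path.trans_apply]
  split_ifs
  · exact hC.segment_subset hx hy (segmentPath_mem _ _)
  · exact hC.segment_subset hy hz (segmentPath_mem _ _)

theorem segmentClass_self {x : A} (h : segment ℝ (x : E) x ⊆ A) :
    segmentClass h = Homotopic.Quotient.refl x :=
  Homotopic.Quotient.eq.2 (Path.homotopic_of_mem_convex _ _ (convex_segment _ _) h (segmentPath_mem h)
    fun _ => left_mem_segment ℝ _ _)

/-- If two consecutive segments overlap outside of their common endpoint, then one of
them contains the other endpoint of the other. -/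
theorem mem_segment_or_mem_segment {u v w p : E} (hpu : p ∈ segment ℝ u v)
    (hpw : p ∈ segment ℝ v w) (hpv : p ≠ v) :
    u ∈ segment ℝ v w ∨ w ∈ segment ℝ u v := by
  rw [segment_symm, mem_segment_iff_wbtw] at hpu
  rw [mem_segment_iff_wbtw] at hpw
  rw [segment_symm ℝ u v, mem_segment_iff_wbtw, mem_segment_iff_wbtw]
  refine wbtw_total_of_sameRay_vsub_left ?_
  exact hpu.sameRay_vsub_left.symm.trans hpw.sameRay_vsub_left
    fun h => absurd (sub_eq_zero.1 h) hpv

theorem exists_segmentClass_trans_eq {u v w : A} {p : E} (huv : segment ℝ (u : E) v ⊆ A)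
    (hvw : segment ℝ (v : E) w ⊆ A) (hpu : p ∈ segment ℝ (u : E) v)
    (hpw : p ∈ segment ℝ (v : E) w) (hpv : p ≠ v) :
    ∃ huw : segment ℝ (u : E) w ⊆ A,
      (segmentClass huv).trans (segmentClass hvw) = segmentClass huw := by
  obtain ⟨C, hC, hCA, hu, hv, hw⟩ :
      ∃ C : Set E, Convex ℝ C ∧ C ⊆ A ∧ (u : E) ∈ C ∧ (v : E) ∈ C ∧ (w : E) ∈ C := by
    rcases mem_segment_or_mem_segment hpu hpw hpv with h | h
    · exact ⟨_, convex_segment _ _, hvw, h, left_mem_segment ℝ _ _, right_mem_segment ℝ _ _⟩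
    · exact ⟨_, convex_segment _ _, huv, left_mem_segment ℝ _ _, right_mem_segment ℝ _ _, h⟩
  exact ⟨(hC.segment_subset hu hw).trans hCA, segmentClass_trans hC hCA hu hv hw _ _ _⟩

/-- A point of a segment splits the class of the segment. -/
theorem segmentClass_split {x y p : A} (h : segment ℝ (x : E) y ⊆ A)
    (hp : (p : E) ∈ segment ℝ (x : E) y) (hxp : segment ℝ (x : E) p ⊆ A)
    (hpy : segment ℝ (p : E) y ⊆ A) :
    segmentClass h = (segmentClass hxp).trans (segmentClass hpy) :=
  (segmentClass_trans (convex_segment _ _) h (left_mem_segment ℝ _ _) hp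
    (right_mem_segment ℝ _ _) _ _ _).symm

/-- A polygonal chain in `A`, given by its consecutive edges. -/
inductive PolygonalChain (A : Set E) : A → A → Type _
  | nil (x : A) : PolygonalChain A x x
  | cons {x y z : A} (h : segment ℝ (x : E) y ⊆ A) (c : PolygonalChain A y z) :
      PolygonalChain A x z

namespace PolygonalChain

/-- The number of edges. -/
def length : ∀ {x y : A}, PolygonalChain A x y → ℕ
  | _, _, nil _ => 0
  | _, _, cons _ c => c.length + 1

/-- The homotopy class of a polygonal chain. -/
noncomputable def toClass : ∀ {x y : A}, PolygonalChain A x y → Homotopic.Quotient x y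
  | _, _, nil x => Homotopic.Quotient.refl x
  | _, _, cons h c => (segmentClass h).trans c.toClass

/-- The union of the edges (empty for a chain without edges). -/
def support : ∀ {x y : A}, PolygonalChain A x y → Set E
  | _, _, nil _ => ∅
  | _, _, cons (x := x) (y := y) _ c => segment ℝ (x : E) y ∪ c.support

/-- Concatenation of polygonal chains. -/
def append : ∀ {x y z : A}, PolygonalChain A x y → PolygonalChain A y z → PolygonalChain A x z
  | _, _, _, nil _, d => d
  | _, _, _, cons h c, d => cons h (c.append d)

@[simp]
theorem length_append : ∀ {x y z : A} (c : PolygonalChain A x y) (d : PolygonalChain A y z),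
    (c.append d).length = c.length + d.length
  | _, _, _, nil _, d => by simp [append, length]
  | _, _, _, cons h c, d => by simp [append, length, length_append c d]; omega

@[simp]
theorem toClass_append : ∀ {x y z : A} (c : PolygonalChain A x y) (d : PolygonalChain A y z),
    (c.append d).toClass = c.toClass.trans d.toClass
  | _, _, _, nil _, d => by simp [append, toClass]
  | _, _, _, cons h c, d => by simp [append, toClass, toClass_append c d]

theorem eq_of_length_eq_zero : ∀ {x y : A} (c : PolygonalChain A x y), c.length = 0 → x = y
  | _, _, nil _, _ => rfl

theorem toClass_of_length_eq_zero : ∀ {x : A} (c : PolygonalChain A x x), c.length = 0 →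
    c.toClass = Homotopic.Quotient.refl x
  | _, nil _, _ => rfl

/-- A point on a chain lies on one of its edges. -/
theorem exists_edge_of_mem_support : ∀ {x y : A} (c : PolygonalChain A x y) {p : E},
    p ∈ c.support → ∃ (u v : A) (c₁ : PolygonalChain A x u) (h : segment ℝ (u : E) v ⊆ A)
      (c₂ : PolygonalChain A v y), p ∈ segment ℝ (u : E) v ∧
      c.toClass = c₁.toClass.trans ((segmentClass h).trans c₂.toClass) ∧
      c.length = c₁.length + c₂.length + 1
  | _, _, cons h c, p, hp => by
    rcases hp with hp | hp
    · exact ⟨_, _, nil _, h, c, hp, by simp [toClass], by simp [length]⟩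
    · obtain ⟨u, v, c₁, k, c₂, hpk, hc, hl⟩ := c.exists_edge_of_mem_support hp
      exact ⟨u, v, cons h c₁, k, c₂, hpk, by simp [toClass, hc], by simp [length, hl]; omega⟩

/-- Every homotopy class of paths in an open set contains a polygonal chain. -/
theorem exists_toClass_eq (hA : IsOpen A) {x y : A} (γ : Path x y) :
    ∃ c : PolygonalChain A x y, c.toClass = Homotopic.Quotient.mk γ := by
  have hloc : ∀ t : I, ∀ᶠ s in 𝓝 t,
      (∃ c : PolygonalChain A (γ t) (γ s), c.toClass = Homotopic.Quotient.mk (γ.subpath t s)) ∧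
      ∃ c : PolygonalChain A (γ s) (γ t), c.toClass = Homotopic.Quotient.mk (γ.subpath s t) := by
    intro t
    obtain ⟨r, hr, hrA⟩ := Metric.isOpen_iff.1 hA (γ t) (γ t).2
    have hcont : Continuous fun s => (γ s : E) := by fun_prop
    obtain ⟨δ, hδ, hball⟩ := Metric.continuous_iff.1 hcont t r hr
    filter_upwards [Metric.ball_mem_nhds t hδ] with s hs
    have hmem : ∀ u ∈ uIcc t s, (γ u : E) ∈ Metric.ball (γ t : E) r := by
      intro u hu
      refine hball u (lt_of_le_of_lt ?_ hs)
      have := abs_sub_left_of_mem_uIcc (show (u : ℝ) ∈ uIcc (t : ℝ) s by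
        rcases mem_uIcc.1 hu with h | h
        · exact mem_uIcc.2 (.inl h)
        · exact mem_uIcc.2 (.inr h))
      simpa [Subtype.dist_eq, Real.dist_eq] using this
    have key : ∀ a b : I, uIcc a b = uIcc t s →
        ∃ c : PolygonalChain A (γ a) (γ b), c.toClass = Homotopic.Quotient.mk (γ.subpath a b) := by
      intro a b hab
      have hseg : segment ℝ (γ a : E) (γ b) ⊆ Metric.ball (γ t : E) r :=
        (convex_ball _ _).segment_subset (hmem a (hab ▸ left_mem_uIcc))
          (hmem b (hab ▸ right_mem_uIcc))
      refine ⟨cons (hseg.trans hrA) (nil _), ?_⟩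
      simp only [toClass, Homotopic.Quotient.trans_refl]
      refine Homotopic.Quotient.eq.2 (Path.homotopic_of_mem_convex _ _ (convex_ball _ r) hrA
        (fun _ => hseg (segmentPath_mem _ _)) fun u => ?_)
      obtain ⟨w, hw, hwu⟩ := (γ.range_subpath a b ▸ mem_range_self u :
        γ.subpath a b u ∈ γ '' uIcc a b)
      exact hwu ▸ hmem w (hab ▸ hw)
    exact ⟨key t s rfl, key s t (uIcc_comm s t)⟩
  let T : Set I := {t | ∃ c : PolygonalChain A (γ 0) (γ t),
    c.toClass = Homotopic.Quotient.mk (γ.subpath 0 t)}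
  have hstep : ∀ s t : I, (∃ c : PolygonalChain A (γ s) (γ t),
      c.toClass = Homotopic.Quotient.mk (γ.subpath s t)) → s ∈ T → t ∈ T := by
    rintro s t ⟨c, hc⟩ ⟨d, hd⟩
    refine ⟨d.append c, ?_⟩
    rw [toClass_append, hc, hd, ← Homotopic.Quotient.mk_trans]
    exact Homotopic.Quotient.eq.2 ⟨Path.Homotopy.subpathTransSubpath γ 0 s t⟩
  have hclopen : IsClopen T := by
    constructor
    · refine isOpen_compl_iff.1 (isOpen_iff_mem_nhds.2 fun t ht => ?_)
      filter_upwards [hloc t] with s hs hsT using ht (hstep s t hs.2 hsT)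
    · refine isOpen_iff_mem_nhds.2 fun t ht => ?_
      filter_upwards [hloc t] with s hs using hstep t s hs.1 ht
  have hT : T = univ := hclopen.eq_univ ⟨0, nil _, by simp [toClass]⟩
  obtain ⟨c, hc⟩ : (1 : I) ∈ T := hT ▸ mem_univ _
  have hcast : ∀ {a b : A} (hx : a = x) (hy : b = y) (q : Homotopic.Quotient x y)
      (d : PolygonalChain A a b), d.toClass = q.cast hx hy →
      ∃ c : PolygonalChain A x y, c.toClass = q := by
    rintro _ _ rfl rfl q d hd
    exact ⟨d, by simpa using hd⟩
  rw [Path.subpath_zero_one, Homotopic.Quotient.mk_cast] at hc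
  exact hcast _ _ _ c hc

/-- A shortest polygonal chain in its homotopy class can be parametrized injectively, provided
that all closed polygonal chains with at most as many edges are null-homotopic. -/
theorem exists_injective_path {m : ℕ}
    (hm : ∀ (x : A) (c : PolygonalChain A x x), c.length ≤ m →
      c.toClass = Homotopic.Quotient.refl x) {x y : A} (c : PolygonalChain A x y)
    (hcm : c.length ≤ m) (hc : c.length ≠ 0)
    (hmin : ∀ d : PolygonalChain A x y, d.toClass = c.toClass → c.length ≤ d.length) :
    ∃ γ : Path x y, Function.Injective γ ∧ Homotopic.Quotient.mk γ = c.toClass ∧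
      ∀ t, (γ t : E) ∈ c.support := by
  induction c with
  | nil x => exact absurd rfl hc
  | @cons x w y h c ih =>
    have hne : x ≠ w := by
      rintro rfl
      have := hmin c (by simp [toClass, segmentClass_self])
      simp [length] at this
    have hcm' : c.length + 1 ≤ m := hcm
    have hmin' : ∀ d : PolygonalChain A x y,
        d.toClass = (segmentClass h).trans c.toClass → c.length + 1 ≤ d.length := hmin
    by_cases hc0 : c.length = 0
    · cases c with
      | cons => simp [length] at hc0
      | nil y =>
        exact ⟨segmentPath h, segmentPath_injective h hne, by simp [toClass, segmentClass],
          fun t => .inl (segmentPath_mem h t)⟩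
    obtain ⟨γ, hγ, hγc, hγs⟩ := ih (by omega) hc0 fun d hd => by
      simpa [length] using hmin' (cons h d) (by simp [toClass, hd])
    have key : ∀ p ∈ segment ℝ (x : E) w, p ∈ c.support → p = w := by
      intro p hp hpc
      by_contra hpw
      obtain ⟨u, v, c₁, k, c₂, hpk, hcc, hl⟩ := c.exists_edge_of_mem_support hpc
      by_cases hc₁ : c₁.length = 0
      · obtain rfl := c₁.eq_of_length_eq_zero hc₁
        obtain ⟨hxv, he⟩ := exists_segmentClass_trans_eq h k hp hpk hpw
        have := hmin' (cons hxv c₂) (by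
          rw [toClass, hcc, c₁.toClass_of_length_eq_zero hc₁, ← he]; simp)
        simp only [length] at this
        omega
      · lift p to A using h hp
        have hxp := ((convex_segment _ _).segment_subset (left_mem_segment ℝ _ _) hp).trans h
        have hpw := ((convex_segment _ _).segment_subset hp (right_mem_segment ℝ _ _)).trans h
        have hup := ((convex_segment _ _).segment_subset (left_mem_segment ℝ _ _) hpk).trans k
        have hpv := ((convex_segment _ _).segment_subset hpk (right_mem_segment ℝ _ _)).trans k
        have hloop := hm p (cons hpw (c₁.append (cons hup (nil p)))) (by
          simp only [length, length_append]; omega)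
        have := hmin' (cons hxp (cons hpv c₂)) (by
          rw [hcc, segmentClass_split h hp hxp hpw, segmentClass_split k hpk hup hpv]
          simp only [toClass, toClass_append] at hloop ⊢
          grind)
        simp only [length] at this
        omega
    refine ⟨(segmentPath h).trans γ, ?_, ?_, ?_⟩
    · have hxy : x ≠ y := fun hxy => by
        have hx : (x : E) ∈ c.support := by simpa [hxy] using hγs 1
        exact hne (Subtype.ext (key x (left_mem_segment ℝ _ _) hx))
      have hmeet : ∀ s t, segmentPath h s = γ t → s = 1 ∧ t = 0 ∨ s = 0 ∧ t = 1 := by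
        intro s t hst
        have hw : segmentPath h s = w :=
          Subtype.ext (key _ (segmentPath_mem h s) (hst ▸ hγs t))
        exact .inl ⟨segmentPath_injective h hne (hw.trans (segmentPath h).target.symm),
          hγ (hst.symm.trans (hw.trans γ.source.symm))⟩
      have hle : ∀ s t : I, s ≤ t → (segmentPath h).trans γ s = (segmentPath h).trans γ t →
          s = t := by
        intro s t hst heq
        rcases Path.eq_or_eq_of_trans_apply_eq (segmentPath_injective h hne) hγ hmeet hst heq with
          hst | ⟨rfl, rfl⟩
        · exact hst
        · exact absurd (by simpa using heq) hxy
      intro s t heq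
      rcases le_total s t with hst | hst
      · exact hle s t hst heq
      · exact (hle t s hst heq.symm).symm
    · simp [toClass, segmentClass, hγc]
    · intro t
      rw [Path.trans_apply]
      split_ifs
      · exact .inl (segmentPath_mem _ _)
      · exact .inr (hγs _)

/-- The closed chain `cons h c` is a simple closed curve up to homotopy if it is a shortest closed
polygonal chain that is not null-homotopic. -/
theorem exists_simple_closed_path {x y : A} (h : segment ℝ (x : E) y ⊆ A)
    (c : PolygonalChain A y x)
    (hm : ∀ (z : A) (d : PolygonalChain A z z), d.length ≤ c.length →
      d.toClass = Homotopic.Quotient.refl z)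
    (hc : (cons h c).toClass ≠ Homotopic.Quotient.refl x) :
    ∃ γ : Path x x, InjOn γ {t : I | (t : ℝ) < 1} ∧ ¬ γ.Homotopic (Path.refl x) := by
  rw [toClass] at hc
  have hne : x ≠ y := by
    rintro rfl
    exact hc (by rw [segmentClass_self, hm _ c le_rfl]; simp)
  have hc0 : c.length ≠ 0 := fun h0 => hne (c.eq_of_length_eq_zero h0).symm
  obtain ⟨γ, hγ, hγc, hγs⟩ := exists_injective_path hm c le_rfl hc0 fun d hd => by
    by_contra! hlt
    exact hc (hd ▸ hm _ (cons h d) (by simpa [length] using hlt))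
  have key : ∀ p ∈ segment ℝ (x : E) y, p ∈ c.support → p = x ∨ p = y := by
    intro p hp hpc
    by_contra! hpne
    obtain ⟨u, v, c₁, k, c₂, hpk, hcc, hl⟩ := c.exists_edge_of_mem_support hpc
    rw [hcc] at hc
    by_cases hc₁ : c₁.length = 0
    · obtain rfl := c₁.eq_of_length_eq_zero hc₁
      obtain ⟨hxv, he⟩ := exists_segmentClass_trans_eq h k hp hpk hpne.2
      have hloop := hm _ (cons hxv c₂) (by simp only [length]; omega)
      refine hc ?_
      rw [c₁.toClass_of_length_eq_zero hc₁, ← hloop, toClass, ← he]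
      simp
    by_cases hc₂ : c₂.length = 0
    · obtain rfl := c₂.eq_of_length_eq_zero hc₂
      obtain ⟨huy, he⟩ := exists_segmentClass_trans_eq k h hpk hp hpne.1
      have hloop := hm _ (cons huy c₁) (by simp only [length]; omega)
      refine hc ?_
      rw [toClass, ← he] at hloop
      rw [c₂.toClass_of_length_eq_zero hc₂]
      have : (segmentClass k).symm = (segmentClass h).trans c₁.toClass := by
        rw [← Homotopic.Quotient.trans_refl (segmentClass k).symm, ← hloop]
        simp [← Homotopic.Quotient.trans_assoc]
      simp [← Homotopic.Quotient.trans_assoc, ← this]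
    lift p to A using h hp
    have hxp := ((convex_segment _ _).segment_subset (left_mem_segment ℝ _ _) hp).trans h
    have hpy := ((convex_segment _ _).segment_subset hp (right_mem_segment ℝ _ _)).trans h
    have hup := ((convex_segment _ _).segment_subset (left_mem_segment ℝ _ _) hpk).trans k
    have hpv := ((convex_segment _ _).segment_subset hpk (right_mem_segment ℝ _ _)).trans k
    have hloop₁ := hm p (cons hpy (c₁.append (cons hup (nil p)))) (by
      simp only [length, length_append]; omega)
    have hloop₂ := hm x (cons hxp (cons hpv c₂)) (by simp only [length]; omega)
    refine hc ?_
    rw [segmentClass_split h hp hxp hpy, segmentClass_split k hpk hup hpv]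
    simp only [toClass, toClass_append] at hloop₁ hloop₂
    grind
  refine ⟨(segmentPath h).trans γ, ?_, fun hhom => hc ?_⟩
  · have hmeet : ∀ s t, segmentPath h s = γ t → s = 1 ∧ t = 0 ∨ s = 0 ∧ t = 1 := by
      intro s t hst
      rcases key _ (segmentPath_mem h s) (hst ▸ hγs t) with hx | hy
      · have hx : segmentPath h s = x := Subtype.ext hx
        exact .inr ⟨segmentPath_injective h hne (hx.trans (segmentPath h).source.symm),
          hγ (hst.symm.trans (hx.trans γ.target.symm))⟩
      · have hy : segmentPath h s = y := Subtype.ext hy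
        exact .inl ⟨segmentPath_injective h hne (hy.trans (segmentPath h).target.symm),
          hγ (hst.symm.trans (hy.trans γ.source.symm))⟩
    have hle : ∀ s t : I, (t : ℝ) < 1 → s ≤ t →
        (segmentPath h).trans γ s = (segmentPath h).trans γ t → s = t := by
      intro s t ht hst heq
      rcases Path.eq_or_eq_of_trans_apply_eq (segmentPath_injective h hne) hγ hmeet hst heq with
        hst | ⟨-, rfl⟩
      · exact hst
      · simp at ht
    intro s hs t ht heq
    rcases le_total s t with hst | hst
    · exact hle s t ht hst heq
    · exact (hle t s hs hst heq.symm).symm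
  · simpa [segmentClass, hγc] using Homotopic.Quotient.eq.2 hhom

end PolygonalChain
end PolygonalChains

/-- Let `A ⊆ ℂ` be open, connected, and not simply connected. Then there exists a
simple closed curve in `A` which is not null-homotopic in `A`: a loop `γ` in `A`
(formalized as a `Path a a` in the subspace `A`) which is injective on `[0,1)` and
not homotopic in `A`, relative to its base point, to the constant loop. -/
theorem exists_simple_closed_curve_not_nullhomotopic (A : Set ℂ) (hA : IsOpen A)
    (hconn : IsConnected A) (hns : ¬ SimplyConnectedSpace A) :
    ∃ (a : A) (γ : Path a a),
      Set.InjOn γ {t : unitInterval | (t : ℝ) < 1} ∧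
      ¬ γ.Homotopic (Path.refl a) := by
  have hpc : PathConnectedSpace A :=
    isPathConnected_iff_pathConnectedSpace.1 (hA.isConnected_iff_isPathConnected.1 hconn)
  rw [simply_connected_iff_loops_nullhomotopic] at hns
  push Not at hns
  obtain ⟨a, α, hα⟩ := hns hpc
  obtain ⟨c₀, hc₀⟩ := PolygonalChain.exists_toClass_eq hA α
  classical
  have hex : ∃ n, ∃ (x : A) (c : PolygonalChain A x x), c.length = n ∧
      c.toClass ≠ Homotopic.Quotient.refl x :=
    ⟨_, a, c₀, rfl, fun h => hα (Homotopic.Quotient.eq.1 (hc₀.symm.trans h))⟩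
  obtain ⟨x, c, hcl, hc⟩ := Nat.find_spec hex
  have hmin : ∀ (z : A) (d : PolygonalChain A z z), d.length < c.length →
      d.toClass = Homotopic.Quotient.refl z := fun z d hd => by
    by_contra hne
    exact Nat.find_min hex (hcl ▸ hd) ⟨z, d, rfl, hne⟩
  cases c with
  | nil => exact absurd rfl hc
  | cons h c =>
    exact ⟨x, PolygonalChain.exists_simple_closed_path h c
      (fun z d hd => hmin z d (Nat.lt_succ_of_le hd)) hc⟩
end

section
/- Let A ⊆ ℂ be open and connected. Then A is simply connected if and only if ℂ∞ \ A is connected, where ℂ∞ = ℂ ∪ {∞} is the Riemann sphere. -/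
open OnePoint
open Set Filter Topology Path.Homotopic

section VanKampen

variable {Y : Type*} [TopologicalSpace Y]

/-- Any two paths in `U` with the same endpoints are homotopic in the ambient space. -/
def PathsHomotopicOn (U : Set Y) : Prop :=
  ∀ ⦃x y : Y⦄ (p q : Path x y), (∀ t, p t ∈ U) → (∀ t, q t ∈ U) → p.Homotopic q

/-- A property of homotopy classes of paths that is stable under appending a path lying in one of
two open sets is stable under appending a path lying in their union. -/
theorem Path.Homotopic.Quotient.trans_mk_of_mem_union {U Q : Set Y} (hU : IsOpen U)
    (hQ : IsOpen Q) {b : Y} {M : ∀ y, Path.Homotopic.Quotient b y → Prop}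
    (hM : ∀ ⦃y z⦄ (c : Path.Homotopic.Quotient b y) (p : Path y z), M y c →
      ((∀ t, p t ∈ U) ∨ ∀ t, p t ∈ Q) → M z (c.trans (.mk p)))
    {x y : Y} (p : Path x y) (hp : ∀ t, p t ∈ U ∪ Q) (c : Path.Homotopic.Quotient b x)
    (hc : M x c) : M y (c.trans (.mk p)) := by
  obtain ⟨t, t0, tmono, ⟨N, hN⟩, ht⟩ := exists_monotone_Icc_subset_open_cover_unitInterval
    (c := fun i : Bool ↦ p ⁻¹' (if i then U else Q))
    (fun i ↦ by cases i <;> simp [hU.preimage p.continuous, hQ.preimage p.continuous])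
    (fun s _ ↦ by
      rcases hp s with h | h
      · exact mem_iUnion.2 ⟨true, by simpa using h⟩
      · exact mem_iUnion.2 ⟨false, by simpa using h⟩)
  have key (c' : Path.Homotopic.Quotient b (p 0)) (hc' : M (p 0) c') (n : ℕ) :
      M (p (t n)) (c'.trans (.mk (p.subpath 0 (t n)))) := by
    induction n with
    | zero =>
      have := hM c' (p.subpath 0 0) hc' (by
        rw [Path.subpath_self]
        rcases hp 0 with h | h
        · exact .inl fun _ ↦ h
        · exact .inr fun _ ↦ h)
      rwa [t0]
    | succ n ih =>
      have h := hM _ (p.subpath (t n) (t (n + 1))) ih (by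
        obtain ⟨i, hi⟩ := ht n
        have : ∀ s, p.subpath (t n) (t (n + 1)) s ∈ p '' Icc (t n) (t (n + 1)) := fun s ↦ by
          rw [← Path.range_subpath_of_le _ _ _ (tmono n.le_succ)]
          exact mem_range_self s
        have hs : ∀ s, p.subpath (t n) (t (n + 1)) s ∈ if i then U else Q := fun s ↦ by
          obtain ⟨r, hr, h⟩ := this s
          rw [← h]
          exact hi hr
        cases i
        · exact .inr (by simpa using hs)
        · exact .inl (by simpa using hs))
      rwa [Quotient.trans_assoc, ← Quotient.mk_trans, Quotient.eq.2
        ⟨Path.Homotopy.subpathTransSubpath p 0 (t n) (t (n + 1))⟩] at h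
  have tr : ∀ {x' y' : Y} (hx : x' = x) (hy : y' = y),
      (∀ c' : Path.Homotopic.Quotient b x', M x' c' → M y' (c'.trans (.mk (p.cast hx hy)))) →
      M y (c.trans (.mk p)) := by
    rintro _ _ rfl rfl h
    exact h c hc
  refine tr p.source p.target fun c' hc' ↦ ?_
  rw [← Path.subpath_zero_one, ← hN N le_rfl]
  exact key c' hc' N

/-- Homotopy classes of paths from `b` that consist of a path in `Q`, possibly followed by a path
in `U`. -/
def IsReached (U Q : Set Y) (b y : Y) (c : Path.Homotopic.Quotient b y) : Prop :=
  (∃ q : Path b y, (∀ t, q t ∈ Q) ∧ .mk q = c) ∨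
    ∃ (z : Y) (q : Path b z) (u : Path z y), (∀ t, q t ∈ Q) ∧ (∀ t, u t ∈ U) ∧
      .mk (q.trans u) = c

theorem Path.trans_mem {U : Set Y} {x y z : Y} {p : Path x y} {q : Path y z}
    (hp : ∀ t, p t ∈ U) (hq : ∀ t, q t ∈ U) (t : unitInterval) : p.trans q t ∈ U := by
  have : p.trans q t ∈ range (p.trans q) := mem_range_self t
  rw [Path.trans_range] at this
  rcases this with ⟨s, hs⟩ | ⟨s, hs⟩
  · exact hs ▸ hp s
  · exact hs ▸ hq s

theorem Path.symm_mem {U : Set Y} {x y : Y} {p : Path x y}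
    (hp : ∀ t, p t ∈ U) (t : unitInterval) : p.symm t ∈ U := hp _

theorem IsReached.of_mem {U Q : Set Y} (hUh : PathsHomotopicOn U)
    (hUQ : ∀ x ∈ U ∩ Q, ∀ y ∈ U ∩ Q, JoinedIn U x y → JoinedIn (U ∩ Q) x y)
    {b y : Y} {c : Path.Homotopic.Quotient b y} (h : IsReached U Q b y c)
    (hy : y ∈ Q) : ∃ q : Path b y, (∀ t, q t ∈ Q) ∧ .mk q = c := by
  rcases h with h | ⟨z, q, u, hq, hu, rfl⟩
  · exact h
  obtain ⟨w, hw⟩ := hUQ z ⟨by simpa using hu 0, by simpa using hq 1⟩ y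
    ⟨by simpa using hu 1, hy⟩ ⟨u, hu⟩
  exact ⟨q.trans w, Path.trans_mem hq fun t ↦ (hw t).2,
    Quotient.eq.2 (.hcomp (.refl q) (hUh w u (fun t ↦ (hw t).1) hu))⟩

theorem IsReached.trans {U Q : Set Y} (hUh : PathsHomotopicOn U)
    (hUQ : ∀ x ∈ U ∩ Q, ∀ y ∈ U ∩ Q, JoinedIn U x y → JoinedIn (U ∩ Q) x y)
    {b y z : Y} (c : Path.Homotopic.Quotient b y) (p : Path y z)
    (h : IsReached U Q b y c) (hp : (∀ t, p t ∈ U) ∨ ∀ t, p t ∈ Q) :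
    IsReached U Q b z (c.trans (.mk p)) := by
  rcases hp with hp | hp
  · rcases h with ⟨q, hq, rfl⟩ | ⟨x, q, u, hq, hu, rfl⟩
    · exact .inr ⟨y, q, p, hq, hp, Quotient.mk_trans _ _⟩
    · refine .inr ⟨x, q, u.trans p, hq, Path.trans_mem hu hp, ?_⟩
      simp only [Quotient.mk_trans, Quotient.trans_assoc]
  · obtain ⟨q, hq, rfl⟩ := h.of_mem hUh hUQ (by simpa using hp 0)
    exact .inl ⟨q.trans p, Path.trans_mem hq hp, Quotient.mk_trans _ _⟩

theorem IsReached.unique {U Q : Set Y} (hUh : PathsHomotopicOn U)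
    (hUQ : ∀ x ∈ U ∩ Q, ∀ y ∈ U ∩ Q, JoinedIn U x y → JoinedIn (U ∩ Q) x y)
    (hQh : PathsHomotopicOn Q) {b y : Y} {c c' : Path.Homotopic.Quotient b y}
    (h : IsReached U Q b y c) (h' : IsReached U Q b y c') : c = c' := by
  by_cases hy : y ∈ Q
  · obtain ⟨q, hq, rfl⟩ := h.of_mem hUh hUQ hy
    obtain ⟨q', hq', rfl⟩ := h'.of_mem hUh hUQ hy
    exact Quotient.eq.2 (hQh q q' hq hq')
  rcases h with ⟨q, hq, -⟩ | ⟨z, q, u, hq, hu, rfl⟩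
  · exact absurd (by simpa using hq 1) hy
  rcases h' with ⟨q, hq, -⟩ | ⟨z', q', u', hq', hu', rfl⟩
  · exact absurd (by simpa using hq 1) hy
  obtain ⟨w, hw⟩ := hUQ z ⟨by simpa using hu 0, by simpa using hq 1⟩ z'
    ⟨by simpa using hu' 0, by simpa using hq' 1⟩
    ⟨u.trans u'.symm, Path.trans_mem hu (Path.symm_mem hu')⟩
  have h1 : Path.Homotopic.Quotient.mk u = .mk (w.trans u') :=
    Path.Homotopic.Quotient.eq.2 (hUh _ _ hu (Path.trans_mem (fun t ↦ (hw t).1) hu'))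
  have h2 : Path.Homotopic.Quotient.mk (q.trans w) = .mk q' :=
    Path.Homotopic.Quotient.eq.2 (hQh _ _ (Path.trans_mem hq fun t ↦ (hw t).2) hq')
  rw [Quotient.mk_trans, h1, Quotient.mk_trans, ← Quotient.trans_assoc, ← Quotient.mk_trans, h2,
    ← Quotient.mk_trans]

/-- A form of the van Kampen theorem: homotopy uniqueness of paths passes to the union of two open
sets when points of the intersection that are joined in `U` are joined in the intersection. -/
theorem PathsHomotopicOn.union {U Q : Set Y} (hUh : PathsHomotopicOn U)
    (hUQ : ∀ x ∈ U ∩ Q, ∀ y ∈ U ∩ Q, JoinedIn U x y → JoinedIn (U ∩ Q) x y)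
    (hU : IsOpen U) (hQ : IsOpen Q) (hQh : PathsHomotopicOn Q) :
    PathsHomotopicOn (U ∪ Q) := by
  have main : ∀ {x y : Y} (p q : Path x y), (∀ t, p t ∈ U ∪ Q) → (∀ t, q t ∈ U ∪ Q) →
      (∃ t, p t ∈ Q) → p.Homotopic q := by
    rintro x y p q hp hq ⟨t, ht⟩
    obtain ⟨c, hc⟩ : ∃ c, IsReached U Q (p t) x c := by
      refine ⟨_, Quotient.trans_mk_of_mem_union hU hQ (M := IsReached U Q (p t))
        (fun _ _ c p ↦ IsReached.trans hUh hUQ c p) ((p.subpath t 0).cast rfl p.source.symm)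
        (fun s ↦ ?_) (.mk (.refl _)) (.inl ⟨_, fun _ ↦ ht, rfl⟩)⟩
      exact hp _
    have := IsReached.unique hUh hUQ hQh
      (Quotient.trans_mk_of_mem_union hU hQ (fun _ _ c p ↦ IsReached.trans hUh hUQ c p) p hp c hc)
      (Quotient.trans_mk_of_mem_union hU hQ (fun _ _ c p ↦ IsReached.trans hUh hUQ c p) q hq c hc)
    refine Path.Homotopic.Quotient.eq.1 ?_
    have h2 := congr(Quotient.trans (Quotient.symm c) $this)
    simpa [← Quotient.trans_assoc] using h2
  intro x y p q hp hq
  by_cases h : ∃ t, p t ∈ Q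
  · exact main p q hp hq h
  by_cases h' : ∃ t, q t ∈ Q
  · exact (main q p hq hp h').symm
  push Not at h h'
  exact hUh p q (fun t ↦ (hp t).resolve_right (h t)) fun t ↦ (hq t).resolve_right (h' t)

end VanKampen

section Logarithm

/-- Two continuous logarithms of the same function up to a constant factor differ by a constant. -/
theorem sub_eq_sub_of_exp_eq_const_mul {K : Set ℂ} (hK : IsPreconnected K) {f g : ℂ → ℂ}
    (hf : ContinuousOn f K) (hg : ContinuousOn g K) {k : ℂ}
    (h : ∀ z ∈ K, Complex.exp (f z) = k * Complex.exp (g z)) {x y : ℂ} (hx : x ∈ K) (hy : y ∈ K) :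
    f x - f y = g x - g y := by
  have key := Complex.isCoveringMap_exp.constOn_of_comp hK (g := fun z ↦ f z - g z) (hf.sub hg)
    (fun z hz w hw ↦ by
      simp only [Subtype.mk.injEq, Complex.exp_sub, h z hz, h w hw]
      simp [Complex.exp_ne_zero]) hx hy
  linear_combination key

/-- The function `z - a` has no continuous logarithm on the union of two connected sets that share a
point to the left of `a` and a point to the right of `a`, where one set passes below `a` and the
other above. -/
theorem not_exists_log_sub {K₁ K₂ : Set ℂ} (h₁ : IsPreconnected K₁) (h₂ : IsPreconnected K₂)
    {a x y : ℂ} (hx₁ : x ∈ K₁) (hx₂ : x ∈ K₂) (hy₁ : y ∈ K₁) (hy₂ : y ∈ K₂)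
    (hxa : x.re < a.re) (hay : a.re < y.re)
    (hK₁ : ∀ z ∈ K₁, z.re = a.re → z.im < a.im) (hK₂ : ∀ z ∈ K₂, z.re = a.re → a.im < z.im) :
    ¬ ∃ f : ℂ → ℂ, ContinuousOn f (K₁ ∪ K₂) ∧ ∀ z ∈ K₁ ∪ K₂, Complex.exp (f z) = z - a := by
  rintro ⟨f, hf, hfa⟩
  have s₁ : ∀ z ∈ K₁, (z - a) * Complex.I ∈ Complex.slitPlane := fun z hz ↦ by
    rw [Complex.mem_slitPlane_iff]
    by_cases h : z.re = a.re
    · left; simpa using hK₁ z hz h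
    · right; simpa [sub_eq_zero] using h
  have s₂ : ∀ z ∈ K₂, -((z - a) * Complex.I) ∈ Complex.slitPlane := fun z hz ↦ by
    rw [Complex.mem_slitPlane_iff]
    by_cases h : z.re = a.re
    · left; simpa using hK₂ z hz h
    · right; simpa [sub_eq_zero, neg_eq_zero, eq_comm] using h
  have e₁ := sub_eq_sub_of_exp_eq_const_mul h₁ (hf.mono subset_union_left)
    (g := fun z ↦ Complex.log ((z - a) * Complex.I)) (k := -Complex.I)
    (ContinuousOn.clog (by fun_prop) s₁) (fun z hz ↦ by
      rw [hfa z (.inl hz), Complex.exp_log (Complex.slitPlane_ne_zero (s₁ z hz))]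
      linear_combination (z - a) * Complex.I_sq) hx₁ hy₁
  have e₂ := sub_eq_sub_of_exp_eq_const_mul h₂ (hf.mono subset_union_right)
    (g := fun z ↦ Complex.log (-((z - a) * Complex.I))) (k := Complex.I)
    (ContinuousOn.clog (by fun_prop) s₂) (fun z hz ↦ by
      rw [hfa z (.inr hz), Complex.exp_log (Complex.slitPlane_ne_zero (s₂ z hz))]
      linear_combination (z - a) * Complex.I_sq) hx₂ hy₂
  have e := congrArg Complex.im (e₁.symm.trans e₂)
  simp only [Complex.sub_im, Complex.log_im] at e
  rw [Complex.arg_neg_eq_arg_add_pi_of_im_neg (by simpa using hxa),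
    Complex.arg_neg_eq_arg_sub_pi_of_im_pos (by simpa using hay)] at e
  linarith [Real.pi_pos]

/-- If `a'` is closer to `a` than every point of `K`, then `(z - a') / (z - a)` has a continuous
logarithm on `K`. -/
theorem exists_log_sub_div_sub {K : Set ℂ} {a a' : ℂ} (h : ∀ z ∈ K, ‖a' - a‖ < ‖z - a‖) :
    ∃ g : ℂ → ℂ, ContinuousOn g K ∧ ∀ z ∈ K, z - a' = Complex.exp (g z) * (z - a) := by
  have h0 : ∀ z ∈ K, z - a ≠ 0 := fun z hz ↦ norm_pos_iff.1 ((norm_nonneg _).trans_lt (h z hz))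
  have hs : ∀ z ∈ K, (z - a') / (z - a) ∈ Complex.slitPlane := fun z hz ↦ by
    refine Complex.ball_one_subset_slitPlane ?_
    rw [mem_ball_iff_norm, div_sub_one (h0 z hz), norm_div,
      div_lt_one (norm_pos_iff.2 (h0 z hz)), show z - a' - (z - a) = -(a' - a) by ring, norm_neg]
    exact h z hz
  refine ⟨fun z ↦ Complex.log ((z - a') / (z - a)),
    ContinuousOn.clog (ContinuousOn.div (by fun_prop) (by fun_prop) h0) hs, fun z hz ↦ ?_⟩
  rw [Complex.exp_log (Complex.slitPlane_ne_zero (hs z hz)), div_mul_cancel₀ _ (h0 z hz)]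

/-- If the complement of `A` in the sphere is connected, then `z - a` has a continuous logarithm
on every compact subset of `A`, for each `a ∉ A`. -/
theorem exists_log_sub_of_isPreconnected {A K : Set ℂ}
    (hA : IsPreconnected (((↑) '' A : Set (OnePoint ℂ))ᶜ)) (hK : IsCompact K) (hKA : K ⊆ A)
    {a : ℂ} (ha : a ∉ A) :
    ∃ f : ℂ → ℂ, ContinuousOn f K ∧ ∀ z ∈ K, Complex.exp (f z) = z - a := by
  by_contra hna
  set G : Set ℂ := {a | ∃ f : ℂ → ℂ, ContinuousOn f K ∧ ∀ z ∈ K, Complex.exp (f z) = z - a}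
  have near : ∀ a ∉ K, ∀ᶠ b in 𝓝 a, b ∉ K ∧ (b ∈ G ↔ a ∈ G) := by
    intro a ha
    obtain ⟨r, hr, hrK⟩ := Metric.isOpen_iff.1 hK.isClosed.isOpen_compl a ha
    filter_upwards [Metric.ball_mem_nhds a hr] with b hb
    refine ⟨hrK hb, ?_⟩
    obtain ⟨g, hg, hge⟩ := exists_log_sub_div_sub (K := K) (a := a) (a' := b) fun z hz ↦ by
      rw [← dist_eq_norm, ← dist_eq_norm]
      refine (Metric.mem_ball.1 hb).trans_le ?_
      by_contra! hlt
      exact hrK hlt hz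
    constructor
    · rintro ⟨f, hf, hfe⟩
      refine ⟨fun z ↦ f z - g z, hf.sub hg, fun z hz ↦ ?_⟩
      rw [Complex.exp_sub, hfe z hz, hge z hz, mul_div_cancel_left₀ _ (Complex.exp_ne_zero _)]
    · rintro ⟨f, hf, hfe⟩
      refine ⟨fun z ↦ g z + f z, hg.add hf, fun z hz ↦ ?_⟩
      rw [Complex.exp_add, hfe z hz, hge z hz]
  obtain ⟨R, hR⟩ := hK.isBounded.exists_norm_le
  have far : ∀ b : ℂ, R < ‖b‖ → b ∈ G := by
    intro b hb
    rcases K.eq_empty_or_nonempty with rfl | ⟨w, hw⟩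
    · exact ⟨0, by simp, by simp⟩
    have hb0 : b ≠ 0 := norm_pos_iff.1 ((norm_nonneg w).trans_lt ((hR w hw).trans_lt hb))
    have hs : ∀ z ∈ K, 1 - z / b ∈ Complex.slitPlane := fun z hz ↦ by
      refine Complex.ball_one_subset_slitPlane ?_
      rw [mem_ball_iff_norm, sub_sub_cancel_left, norm_neg, norm_div,
        div_lt_one (norm_pos_iff.2 hb0)]
      exact (hR z hz).trans_lt hb
    refine ⟨fun z ↦ Complex.log (-b) + Complex.log (1 - z / b),
      continuousOn_const.add (ContinuousOn.clog (by fun_prop) hs), fun z hz ↦ ?_⟩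
    rw [Complex.exp_add, Complex.exp_log (neg_ne_zero.2 hb0),
      Complex.exp_log (Complex.slitPlane_ne_zero (hs z hz))]
    field_simp
    ring
  have hopen : IsOpen (Kᶜ ∩ Gᶜ) := isOpen_iff_mem_nhds.2 fun b hb ↦ by
    filter_upwards [near b hb.1] with c hc
    exact ⟨hc.1, fun h ↦ hb.2 (hc.2.1 h)⟩
  have hclosed : IsClosed (K ∪ Gᶜ) := by
    rw [← isOpen_compl_iff]
    refine isOpen_iff_mem_nhds.2 fun b hb ↦ ?_
    simp only [compl_union, compl_compl] at hb ⊢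
    filter_upwards [near b hb.1] with c hc
    exact ⟨hc.1, hc.2.2 hb.2⟩
  have hcomp : IsCompact (K ∪ Gᶜ) := by
    refine Metric.isCompact_of_isClosed_isBounded hclosed
      ((hK.isBounded).union ?_)
    refine isBounded_iff_forall_norm_le.2 ⟨R, fun b hb ↦ ?_⟩
    by_contra! h
    exact hb (far b h)
  obtain ⟨w, hwA, hw1, hw2⟩ := hA (OnePoint.some '' (K ∪ Gᶜ))ᶜ (OnePoint.some '' (Kᶜ ∩ Gᶜ))
    (OnePoint.isOpen_compl_image_coe.2 ⟨hclosed, hcomp⟩) (OnePoint.isOpen_image_coe.2 hopen)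
    (fun w hw ↦ by
      by_cases h : w ∈ ((↑) '' (K ∪ Gᶜ) : Set (OnePoint ℂ))
      · obtain ⟨z, hz, rfl⟩ := h
        have hzK : z ∉ K := fun h ↦ hw ⟨z, hKA h, rfl⟩
        exact .inr ⟨z, ⟨hzK, hz.resolve_left hzK⟩, rfl⟩
      · exact .inl h)
    ⟨∞, OnePoint.infty_notMem_image_coe, OnePoint.infty_notMem_image_coe⟩
    ⟨a, by simpa using ha, a, ⟨fun h ↦ ha (hKA h), hna⟩, rfl⟩
  obtain ⟨z, hz, rfl⟩ := hw2
  exact hw1 ⟨z, .inr hz.2, rfl⟩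

end Logarithm

section Sweep

/-- The abscissae over which the closed vertical segment between heights `n * s` and `(n + 2) * s`
lies in `A`. -/
def columns (A : Set ℂ) (s : ℝ) (n : ℤ) : Set ℝ :=
  {x | ∀ h ∈ Icc (n * s) ((n + 2) * s), (⟨x, h⟩ : ℂ) ∈ A}

/-- The open rectangle in the `i.1`-th horizontal strip over the component of `i.2` in `columns`. -/
def box (A : Set ℂ) (s : ℝ) (i : ℤ × ℝ) : Set ℂ :=
  {z | z.re ∈ connectedComponentIn (columns A s i.1) i.2 ∧ z.im ∈ Ioo (i.1 * s) ((i.1 + 2) * s)}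

variable {A : Set ℂ} {s : ℝ}

theorem continuous_complex_mk : Continuous fun p : ℝ × ℝ ↦ (⟨p.1, p.2⟩ : ℂ) :=
  Complex.equivRealProdCLM.symm.continuous

theorem isOpen_columns (hA : IsOpen A) (n : ℤ) : IsOpen (columns A s n) := by
  refine isOpen_iff_mem_nhds.2 fun x hx ↦ ?_
  refine isCompact_Icc.eventually_forall_of_forall_eventually fun h hh ↦ ?_
  exact continuous_complex_mk.continuousAt.eventually_mem (hA.mem_nhds (hx h hh))

theorem isOpen_box (hA : IsOpen A) (i : ℤ × ℝ) : IsOpen (box A s i) :=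
  ((isOpen_columns hA i.1).connectedComponentIn.preimage Complex.continuous_re).inter
    (isOpen_Ioo.preimage Complex.continuous_im)

theorem box_subset (i : ℤ × ℝ) : box A s i ⊆ A := fun z hz ↦
  connectedComponentIn_subset _ _ hz.1 z.im (Ioo_subset_Icc_self hz.2)

theorem convex_box (i : ℤ × ℝ) : Convex ℝ (box A s i) := by
  have h : Convex ℝ (connectedComponentIn (columns A s i.1) i.2) :=
    isPreconnected_connectedComponentIn.ordConnected.convex
  exact (h.linear_preimage Complex.reLm).inter ((convex_Ioo _ _).linear_preimage Complex.imLm)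

theorem box_eq_box {n : ℤ} {x y c : ℝ} (hx : c ∈ connectedComponentIn (columns A s n) x)
    (hy : c ∈ connectedComponentIn (columns A s n) y) : box A s (n, x) = box A s (n, y) := by
  simp only [box, connectedComponentIn_eq hx, connectedComponentIn_eq hy]

theorem fst_eq_of_mem_box {i j : ℤ × ℝ} (hij : j.1 ≤ i.1) (hs : 0 < s)
    (hne : ¬ box A s i ⊆ box A s j) {z : ℂ} (hi : z ∈ box A s i) (hj : z ∈ box A s j) :
    j.1 = i.1 - 1 := by
  obtain ⟨n, x⟩ := i
  obtain ⟨m, y⟩ := j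
  have h1 : m ≠ n := by
    rintro rfl
    exact hne (box_eq_box hi.1 hj.1).le
  have h2 : (n : ℝ) < m + 2 := lt_of_mul_lt_mul_right (hi.2.1.trans hj.2.2) hs.le
  have h3 : n < m + 2 := by exact_mod_cast h2
  dsimp only at hij ⊢
  omega

theorem Icc_subset_columns (hA : IsPreconnected (((↑) '' A : Set (OnePoint ℂ))ᶜ)) (hs : 0 < s)
    {F : Finset (ℤ × ℝ)} {i : ℤ × ℝ} (hF : ∀ j ∈ F, j.1 ≤ i.1)
    (hne : ∀ j ∈ F, ¬ box A s i ⊆ box A s j) {x y : ℂ} (hx : x ∈ box A s i) (hy : y ∈ box A s i)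
    (hxc : x.re ∈ columns A s (i.1 - 1)) (hyc : y.re ∈ columns A s (i.1 - 1))
    (hxy : JoinedIn (⋃ j ∈ F, box A s j) x y) :
    Icc x.re y.re ⊆ columns A s (i.1 - 1) := by
  intro c hc
  by_contra hcc
  have hxc' : x.re < c := hc.1.lt_of_ne fun h ↦ hcc (h ▸ hxc)
  have hcy' : c < y.re := hc.2.lt_of_ne fun h ↦ hcc (h ▸ hyc)
  have hcomp : Icc x.re y.re ⊆ connectedComponentIn (columns A s i.1) i.2 :=
    isPreconnected_connectedComponentIn.ordConnected.out hx.1 hy.1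
  simp only [columns, Set.mem_ofPred_eq, not_forall] at hcc
  obtain ⟨h, hh, haA⟩ := hcc
  push_cast at hh
  obtain ⟨δ, hδ⟩ := hxy
  set t : ℝ := (i.1 + 3 / 2) * s with ht
  have hht : h < t := by nlinarith [hh.2]
  have htm : t ∈ Ioo (i.1 * s) ((i.1 + 2) * s) := ⟨by nlinarith, by nlinarith⟩
  have vert : ∀ c, Continuous fun r : ℝ ↦ (⟨c, r⟩ : ℂ) := fun c ↦
    continuous_complex_mk.comp (by fun_prop : Continuous fun r : ℝ ↦ (c, r))
  have horiz : Continuous fun r : ℝ ↦ (⟨r, t⟩ : ℂ) :=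
    continuous_complex_mk.comp (by fun_prop : Continuous fun r : ℝ ↦ (r, t))
  set V₁ : Set ℂ := (fun r : ℝ ↦ (⟨x.re, r⟩ : ℂ)) '' uIcc x.im t
  set V₂ : Set ℂ := (fun r : ℝ ↦ (⟨y.re, r⟩ : ℂ)) '' uIcc y.im t
  set H : Set ℂ := (fun r : ℝ ↦ (⟨r, t⟩ : ℂ)) '' Icc x.re y.re
  have hpre : IsPreconnected (V₁ ∪ (H ∪ V₂)) := by
    refine IsPreconnected.union ⟨x.re, t⟩ ⟨t, right_mem_uIcc, rfl⟩
      (.inl ⟨x.re, left_mem_Icc.2 (hc.1.trans hc.2), rfl⟩)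
      (isPreconnected_uIcc.image _ (vert _).continuousOn) ?_
    exact IsPreconnected.union ⟨y.re, t⟩ ⟨y.re, right_mem_Icc.2 (hc.1.trans hc.2), rfl⟩
      ⟨t, right_mem_uIcc, rfl⟩ (isPreconnected_Icc.image _ horiz.continuousOn)
      (isPreconnected_uIcc.image _ (vert _).continuousOn)
  have hcpt : IsCompact (V₁ ∪ (H ∪ V₂)) :=
    (isCompact_uIcc.image (vert _)).union
      ((isCompact_Icc.image horiz).union (isCompact_uIcc.image (vert _)))
  have hsub : V₁ ∪ (H ∪ V₂) ⊆ A := by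
    refine Subset.trans ?_ (box_subset (s := s) i)
    rintro _ (⟨r, hr, rfl⟩ | ⟨r, hr, rfl⟩ | ⟨r, hr, rfl⟩)
    · exact ⟨hx.1, ordConnected_Ioo.uIcc_subset hx.2 htm hr⟩
    · exact ⟨hcomp hr, htm⟩
    · exact ⟨hy.1, ordConnected_Ioo.uIcc_subset hy.2 htm hr⟩
  have hδA : range δ ⊆ A := by
    rintro _ ⟨r, rfl⟩
    obtain ⟨j, -, hj⟩ := mem_iUnion₂.1 (hδ r)
    exact box_subset j hj
  refine not_exists_log_sub (a := ⟨c, h⟩) (x := x) (y := y)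
    (isPreconnected_range δ.continuous) hpre ⟨0, δ.source⟩ (.inl ⟨x.im, left_mem_uIcc, rfl⟩)
    ⟨1, δ.target⟩ (.inr (.inr ⟨y.im, left_mem_uIcc, rfl⟩)) hxc' hcy' ?_ ?_
    (exists_log_sub_of_isPreconnected hA ((isCompact_range δ.continuous).union hcpt)
      (union_subset hδA hsub) haA)
  · rintro _ ⟨r, rfl⟩ (hr : (δ r).re = c)
    obtain ⟨j, hjF, hj⟩ := mem_iUnion₂.1 (hδ r)
    by_contra! hle
    change h ≤ (δ r).im at hle
    have hcj : c ∈ connectedComponentIn (columns A s j.1) j.2 := hr ▸ hj.1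
    have hlt : j.1 ≤ i.1 - 1 := by
      by_contra! hlt
      have heq : i.1 = j.1 := by have := hF j hjF; omega
      refine hne j hjF ?_
      obtain ⟨n, u⟩ := i
      obtain ⟨m, v⟩ := j
      obtain rfl : n = m := heq
      exact (box_eq_box (hcomp hc) hcj).le
    have hlt' : (j.1 : ℝ) ≤ i.1 - 1 := by exact_mod_cast hlt
    refine haA (connectedComponentIn_subset _ _ hcj h ⟨?_, (hle.trans_lt hj.2.2).le⟩)
    exact (mul_le_mul_of_nonneg_right hlt' hs.le).trans hh.1
  · rintro _ (⟨r, hr, rfl⟩ | ⟨r, hr, rfl⟩ | ⟨r, hr, rfl⟩) hrc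
    · exact absurd hrc hxc'.ne
    · exact hht
    · exact absurd hrc hcy'.ne'

theorem joinedIn_inter_box (hA : IsPreconnected (((↑) '' A : Set (OnePoint ℂ))ᶜ)) (hs : 0 < s)
    {F : Finset (ℤ × ℝ)} {i : ℤ × ℝ} (hF : ∀ j ∈ F, j.1 ≤ i.1)
    (hne : ∀ j ∈ F, ¬ box A s i ⊆ box A s j) {x y : ℂ} (hx : x ∈ box A s i) (hy : y ∈ box A s i)
    (hxy : JoinedIn (⋃ j ∈ F, box A s j) x y) :
    JoinedIn ((⋃ j ∈ F, box A s j) ∩ box A s i) x y := by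
  obtain ⟨j, hj, hxj⟩ := mem_iUnion₂.1 hxy.source_mem
  obtain ⟨k, hk, hyk⟩ := mem_iUnion₂.1 hxy.target_mem
  have hj1 := fst_eq_of_mem_box (hF j hj) hs (hne j hj) hx hxj
  have hk1 := fst_eq_of_mem_box (hF k hk) hs (hne k hk) hy hyk
  have hxc : x.re ∈ columns A s (i.1 - 1) := hj1 ▸ connectedComponentIn_subset _ _ hxj.1
  have hyc : y.re ∈ columns A s (i.1 - 1) := hk1 ▸ connectedComponentIn_subset _ _ hyk.1
  have hsub : uIcc x.re y.re ⊆ columns A s j.1 := by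
    rw [hj1]
    rcases le_total x.re y.re with h | h
    · rw [uIcc_of_le h]
      exact Icc_subset_columns hA hs hF hne hx hy hxc hyc hxy
    · rw [uIcc_of_ge h]
      exact Icc_subset_columns hA hs hF hne hy hx hyc hxc hxy.symm
  have hyj : y ∈ box A s j := by
    refine ⟨?_, by rw [hj1, ← hk1]; exact hyk.2⟩
    rw [connectedComponentIn_eq hxj.1]
    exact isPreconnected_uIcc.subset_connectedComponentIn left_mem_uIcc hsub right_mem_uIcc
  have hconv := ((convex_box (A := A) (s := s) j).inter (convex_box i)).isPathConnected
    ⟨x, hxj, hx⟩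
  exact (hconv.joinedIn x ⟨hxj, hx⟩ y ⟨hyj, hy⟩).mono
    (inter_subset_inter_left _ (subset_biUnion_of_mem (u := fun j ↦ box A s j) hj))

theorem pathsHomotopicOn_preimage_of_convex {Q : Set ℂ} (hQ : Convex ℝ Q) (hQA : Q ⊆ A) :
    PathsHomotopicOn ((↑) ⁻¹' Q : Set A) := by
  intro x y p q hp hq
  have hx : (x : ℂ) ∈ Q := by simpa using hp 0
  have hy : (y : ℂ) ∈ Q := by simpa using hp 1
  have : ContractibleSpace Q := hQ.contractibleSpace ⟨x, hx⟩
  let lift (p : Path x y) (hp : ∀ t, p t ∈ ((↑) ⁻¹' Q : Set A)) :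
      Path (⟨x, hx⟩ : Q) ⟨y, hy⟩ :=
    { toFun := fun t ↦ ⟨p t, hp t⟩
      continuous_toFun := by fun_prop
      source' := by simp
      target' := by simp }
  exact (SimplyConnectedSpace.paths_homotopic (lift p hp) (lift q hq)).map
    ⟨inclusion hQA, continuous_inclusion hQA⟩

theorem joinedIn_preimage_coe_iff {S : Set ℂ} (hS : S ⊆ A) {x y : A} :
    JoinedIn ((↑) ⁻¹' S : Set A) x y ↔ JoinedIn S (x : ℂ) y := by
  constructor
  · rintro ⟨p, hp⟩
    exact ⟨p.map continuous_subtype_val, hp⟩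
  · rintro ⟨p, hp⟩
    exact ⟨{ toFun := fun t ↦ ⟨p t, hS (hp t)⟩
             continuous_toFun := by fun_prop
             source' := by simp
             target' := by simp }, hp⟩

theorem pathsHomotopicOn_preimage_iUnion_box (hAo : IsOpen A)
    (hA : IsPreconnected (((↑) '' A : Set (OnePoint ℂ))ᶜ)) (hs : 0 < s) (F : Finset (ℤ × ℝ)) :
    PathsHomotopicOn ((↑) ⁻¹' ⋃ j ∈ F, box A s j : Set A) := by
  classical
  induction F using Finset.induction_on_max_value (fun i : ℤ × ℝ ↦ i.1) with
  | empty =>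
    intro x y p q hp
    simp at hp
  | insert i F _ hF ih =>
    rw [Finset.set_biUnion_insert, union_comm]
    by_cases hne : ∃ j ∈ F, box A s i ⊆ box A s j
    · obtain ⟨j, hj, hij⟩ := hne
      have : box A s i ⊆ ⋃ j ∈ F, box A s j := fun z hz ↦ mem_iUnion₂.2 ⟨j, hj, hij hz⟩
      rwa [union_eq_self_of_subset_right this]
    push Not at hne
    have hsub : ⋃ j ∈ F, box A s j ⊆ A := iUnion₂_subset fun j _ ↦ box_subset j
    rw [preimage_union]
    refine ih.union ?_
      ((isOpen_biUnion fun j _ ↦ isOpen_box hAo j).preimage continuous_subtype_val)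
      ((isOpen_box hAo i).preimage continuous_subtype_val)
      (pathsHomotopicOn_preimage_of_convex (convex_box i) (box_subset i))
    intro x hx y hy hxy
    rw [← preimage_inter, joinedIn_preimage_coe_iff (inter_subset_left.trans hsub)]
    exact joinedIn_inter_box hA hs hF hne hx.2 hy.2 ((joinedIn_preimage_coe_iff hsub).1 hxy)

theorem exists_subset_iUnion_box (hAo : IsOpen A) {K : Set ℂ} (hK : IsCompact K) (hKA : K ⊆ A) :
    ∃ s > 0, ∃ F : Finset (ℤ × ℝ), K ⊆ ⋃ j ∈ F, box A s j := by
  obtain ⟨δ, hδ, hδA⟩ := hK.exists_cthickening_subset_open hAo hKA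
  refine ⟨δ / 2, by positivity, hK.elim_finite_subcover _ (fun i ↦ isOpen_box hAo i) ?_⟩
  intro z hz
  set n : ℤ := ⌈z.im / (δ / 2)⌉ - 1 with hn
  have h1 : (n : ℝ) * (δ / 2) < z.im := by
    rw [← lt_div_iff₀ (by positivity), hn]
    push_cast
    linarith [Int.ceil_lt_add_one (z.im / (δ / 2))]
  have h2 : z.im ≤ (n + 1) * (δ / 2) := by
    rw [← div_le_iff₀ (by positivity), hn]
    push_cast
    linarith [Int.le_ceil (z.im / (δ / 2))]
  refine mem_iUnion.2 ⟨(n, z.re), mem_connectedComponentIn fun h hh ↦ hδA ?_, h1, ?_⟩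
  · refine Metric.mem_cthickening_of_dist_le _ z δ K hz ?_
    have hdist : dist (⟨z.re, h⟩ : ℂ) z = dist h z.im := Complex.dist_of_re_eq rfl
    dsimp only at hh
    rw [hdist, Real.dist_eq, abs_le]
    constructor <;> nlinarith [hh.1, hh.2]
  · dsimp only
    nlinarith

/-- A connected open set whose complement in the sphere is connected is simply connected. -/
theorem simplyConnectedSpace_of_isPreconnected_compl (hAo : IsOpen A) (hconn : IsConnected A)
    (hA : IsPreconnected (((↑) '' A : Set (OnePoint ℂ))ᶜ)) : SimplyConnectedSpace A := by
  rw [simply_connected_iff_loops_nullhomotopic]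
  refine ⟨isPathConnected_iff_pathConnectedSpace.1 (hAo.isConnected_iff_isPathConnected.1 hconn),
    fun x γ ↦ ?_⟩
  obtain ⟨s, hs, F, hF⟩ := exists_subset_iUnion_box hAo
    (isCompact_range (continuous_subtype_val.comp γ.continuous))
    (by rintro _ ⟨t, rfl⟩; exact (γ t).2)
  refine pathsHomotopicOn_preimage_iUnion_box hAo hA hs F γ (.refl x)
    (fun t ↦ hF (mem_range_self t)) fun t ↦ hF ⟨0, by simp⟩

end Sweep

section Necessity

/-- A continuous nowhere vanishing function on the plane does not agree with `z - a` off a bounded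
set. -/
theorem exists_eq_zero_of_eq_sub {G : ℂ → ℂ} (hG : Continuous G) {a : ℂ} {R : ℝ}
    (hGa : ∀ z, R ≤ ‖z - a‖ → G z = z - a) : ∃ z, G z = 0 := by
  by_contra! h0
  wlog hR : 0 < R generalizing R
  · exact this (fun z hz ↦ hGa z ((not_lt.1 hR).trans ((norm_nonneg _)))) one_pos
  obtain ⟨f, hf, hfG⟩ := Complex.exists_continuousOn_eqOn_exp_comp (U := univ) (g := G)
    (show SimplyConnectedSpace (univ : Set ℂ) from
      (Homeomorph.Set.univ ℂ).toHomotopyEquiv.simplyConnectedSpace)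
    isOpen_univ hG.continuousOn (by simpa using h0)
  set e : ℝ → ℂ := fun θ ↦ a + R * Complex.exp (θ * Complex.I) with he
  have hec : Continuous e := by fun_prop
  have hre : ∀ θ, (e θ).re = a.re + R * Real.cos θ := fun θ ↦ by
    simp [he, Complex.exp_ofReal_mul_I_re]
  have him : ∀ θ, (e θ).im = a.im + R * Real.sin θ := fun θ ↦ by
    simp [he, Complex.exp_ofReal_mul_I_im]
  have hnorm : ∀ θ, R ≤ ‖e θ - a‖ := fun θ ↦ by
    simp [he, Complex.norm_exp_ofReal_mul_I, abs_of_pos hR]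
  have hcos : ∀ θ, (e θ).re = a.re → Real.sin θ ≠ 0 := fun θ h h' ↦ by
    have : Real.cos θ = 0 := by simpa [hre, hR.ne'] using h
    nlinarith [Real.sin_sq_add_cos_sq θ]
  have e1 : e (-Real.pi) = e Real.pi := by
    apply Complex.ext <;> simp [hre, him]
  refine not_exists_log_sub (K₁ := e '' Icc (-Real.pi) 0) (K₂ := e '' Icc 0 Real.pi) (a := a)
    (isPreconnected_Icc.image _ hec.continuousOn) (isPreconnected_Icc.image _ hec.continuousOn)
    (x := e Real.pi) (y := e 0)
    ⟨-Real.pi, left_mem_Icc.2 (by linarith [Real.pi_pos]), e1⟩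
    ⟨Real.pi, right_mem_Icc.2 Real.pi_pos.le, rfl⟩
    ⟨0, right_mem_Icc.2 (by linarith [Real.pi_pos]), rfl⟩
    ⟨0, left_mem_Icc.2 Real.pi_pos.le, rfl⟩ (by simp [hre, hR]) (by simp [hre, hR]) ?_ ?_
    ⟨f, hf.mono (subset_univ _), ?_⟩
  · rintro _ ⟨θ, hθ, rfl⟩ h
    have := (Real.sin_nonpos_of_nonpos_of_neg_pi_le hθ.2 hθ.1).lt_of_ne (hcos θ h)
    rw [him]
    nlinarith
  · rintro _ ⟨θ, hθ, rfl⟩ h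
    have := (Real.sin_nonneg_of_nonneg_of_le_pi hθ.1 hθ.2).lt_of_ne (hcos θ h).symm
    rw [him]
    nlinarith
  · rintro _ (⟨θ, -, rfl⟩ | ⟨θ, -, rfl⟩) <;>
      exact (hfG (mem_univ _)).trans (hGa _ (hnorm θ))

/-- The complement of a simply connected open set is not the union of a nonempty compact set and
a closed set disjoint from it. -/
theorem eq_empty_of_compl_eq_union {A K L : Set ℂ} (hAo : IsOpen A) (hA : SimplyConnectedSpace A)
    (hK : IsCompact K) (hL : IsClosed L) (hKL : Disjoint K L) (hAKL : Aᶜ = K ∪ L) : K = ∅ := by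
  classical
  by_contra! hne
  obtain ⟨a, ha⟩ := hne
  have haA : a ∉ A := by
    rw [← mem_compl_iff, hAKL]
    exact .inl ha
  obtain ⟨f, hf, hfA⟩ := Complex.exists_continuousOn_eqOn_exp_comp (U := A) (g := fun z ↦ z - a)
    hA hAo (by fun_prop) (by
      rintro ⟨z, hz, h⟩
      exact haA (sub_eq_zero.1 h ▸ hz))
  obtain ⟨R, hR⟩ := hK.isBounded.subset_ball a
  obtain ⟨φ, hφK, hφL, -⟩ := exists_continuous_zero_one_of_isClosed hK.isClosed
    (hL.union (Metric.isOpen_ball (x := a) (ε := R)).isClosed_compl)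
    (disjoint_union_right.2 ⟨hKL, disjoint_compl_right.mono_left hR⟩)
  have hφL' : ∀ z ∈ L, φ z = 1 := fun z hz ↦ hφL (.inl hz)
  have hφK' : ∀ z ∈ K, φ z = 0 := fun z hz ↦ hφK hz
  set ψ : ℂ → ℝ := fun z ↦ max 0 (min 1 (3 * φ z - 1)) with hψ
  have hψc : Continuous ψ := by fun_prop
  have hψ0 : ∀ z, φ z < 1 / 3 → ψ z = 0 := fun z hz ↦
    max_eq_left ((min_le_right _ _).trans (by linarith))
  have hψ1 : ∀ z, 2 / 3 < φ z → ψ z = 1 := fun z hz ↦ by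
    simp only [hψ]
    rw [min_eq_left (by linarith), max_eq_right zero_le_one]
  set G : ℂ → ℂ := fun z ↦ if z ∈ A then Complex.exp (ψ z * f z) else if z ∈ K then 1 else z - a
    with hG
  have hG₁ : ∀ z, φ z < 1 / 3 → G z = 1 := fun z hz ↦ by
    by_cases hzA : z ∈ A
    · simp [hG, hzA, hψ0 z hz]
    have hzK : z ∈ K := by
      rcases (hAKL ▸ hzA : z ∈ K ∪ L) with h | h
      · exact h
      · linarith [hφL' z h]
    simp [hG, hzA, hzK]
  have hG₂ : ∀ z, 2 / 3 < φ z → G z = z - a := fun z hz ↦ by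
    by_cases hzA : z ∈ A
    · simpa [hG, hzA, hψ1 z hz] using hfA hzA
    have hzK : z ∉ K := fun h ↦ by linarith [hφK' z h]
    simp [hG, hzA, hzK]
  have hGc : Continuous G := by
    rw [continuous_iff_continuousAt]
    intro z
    by_cases hzA : z ∈ A
    · have : ContinuousAt (fun z ↦ Complex.exp (ψ z * f z)) z :=
        ((Complex.continuous_ofReal.comp hψc).continuousAt.mul
          (hf.continuousAt (hAo.mem_nhds hzA))).cexp
      refine this.congr ?_
      filter_upwards [hAo.mem_nhds hzA] with w hw
      simp [hG, hw]
    rcases (hAKL ▸ hzA : z ∈ K ∪ L) with h | h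
    · refine (continuousAt_const (y := (1 : ℂ))).congr ?_
      filter_upwards [φ.continuous.continuousAt.eventually_lt_const
        (show φ z < 1 / 3 by rw [hφK' z h]; norm_num)] with w hw
      exact (hG₁ w hw).symm
    · refine (continuous_id.sub continuous_const).continuousAt.congr (f := fun z ↦ z - a) ?_
      filter_upwards [φ.continuous.continuousAt.eventually_const_lt
        (show 2 / 3 < φ z by rw [hφL' z h]; norm_num)] with w hw
      exact (hG₂ w hw).symm
  obtain ⟨z, hz⟩ := exists_eq_zero_of_eq_sub hGc (a := a) (R := R) fun z hz ↦ by
    refine hG₂ z ?_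
    have : φ z = 1 := hφL (.inr (by simpa [dist_eq_norm] using hz))
    rw [this]
    norm_num
  by_cases hzA : z ∈ A
  · simp [hG, hzA, Complex.exp_ne_zero] at hz
  by_cases hzK : z ∈ K
  · simp [hG, hzA, hzK] at hz
  · simp only [hG, hzA, hzK, if_false] at hz
    exact hzK (sub_eq_zero.1 hz ▸ ha)

/-- The complement in the sphere of a simply connected open set is connected. -/
theorem isPreconnected_compl_of_simplyConnectedSpace {A : Set ℂ} (hAo : IsOpen A)
    (hA : SimplyConnectedSpace A) : IsPreconnected (((↑) '' A : Set (OnePoint ℂ))ᶜ) := by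
  have hcl : IsClosed (((↑) '' A : Set (OnePoint ℂ))ᶜ) :=
    (OnePoint.isOpen_image_coe.2 hAo).isClosed_compl
  rw [isPreconnected_iff_subset_of_fully_disjoint_closed hcl]
  intro u v hu hv huv hdisj
  wlog hinf : ∞ ∈ v generalizing u v
  · have h : ∞ ∈ u := (huv OnePoint.infty_notMem_image_coe).resolve_right hinf
    exact (this v u hv hu (by rwa [union_comm]) hdisj.symm h).symm
  right
  have hnu : ∞ ∉ u ∩ ((↑) '' A : Set (OnePoint ℂ))ᶜ := fun h ↦ disjoint_left.1 hdisj h.1 hinf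
  have hempty := eq_empty_of_compl_eq_union hAo hA
    ((OnePoint.isClosed_iff_of_notMem hnu).1 (hu.inter hcl)).2
    ((hv.inter hcl).preimage OnePoint.continuous_coe)
    ((hdisj.mono inter_subset_left inter_subset_left).preimage _) (by
      rw [← preimage_union, ← union_inter_distrib_right, inter_eq_right.2 huv, preimage_compl,
        preimage_image_eq _ OnePoint.coe_injective])
  intro w hw
  refine (huv hw).resolve_left fun hwu ↦ ?_
  induction w using OnePoint.rec with
  | infty => exact hnu ⟨hwu, hw⟩
  | coe z =>
    have hz : z ∈ (OnePoint.some ⁻¹' (u ∩ (OnePoint.some '' A)ᶜ) : Set ℂ) := ⟨hwu, hw⟩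
    rw [hempty] at hz
    exact hz

end Necessity

/-- Let `A ⊆ ℂ` be open and connected. Then `A` is simply connected (as a subspace)
if and only if `ℂ∞ \ A` is connected, where `ℂ∞` is the Riemann sphere (the
one-point compactification of `ℂ`) and `A` is regarded as a subset of `ℂ∞` via
the canonical inclusion. -/
theorem simplyConnected_iff_compl_connected_onePoint (A : Set ℂ) (hA : IsOpen A)
    (hconn : IsConnected A) :
    SimplyConnectedSpace A ↔ IsConnected (((↑) '' A : Set (OnePoint ℂ))ᶜ) :=
  ⟨fun h ↦ ⟨⟨∞, OnePoint.infty_notMem_image_coe⟩,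
    isPreconnected_compl_of_simplyConnectedSpace hA h⟩,
    fun h ↦ simplyConnectedSpace_of_isPreconnected_compl hA hconn h.isPreconnected⟩
end

section
/- Let A ⊆ ℂ be open. Then every connected component of A is simply connected if and only if ℂ∞ \ A is connected, where ℂ∞ = ℂ ∪ {∞} is the Riemann sphere. -/
open OnePoint
open scoped Topology

/-- Vertices of the grid `ℤ × ℤ` that can be reached from `(i₀, j₀)` along horizontal edges
`(i, j) — (i + 1, j)` with `(i, j) ∈ H` and vertical edges `(i, j) — (i, j + 1)` with
`(i, j) ∈ V`. -/
inductive GridReach (H V : Finset (ℤ × ℤ)) (i₀ j₀ : ℤ) : ℤ → ℤ → Prop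
  | refl : GridReach H V i₀ j₀ i₀ j₀
  | right {i j : ℤ} : (i, j) ∈ H → GridReach H V i₀ j₀ i j → GridReach H V i₀ j₀ (i + 1) j
  | left {i j : ℤ} : (i, j) ∈ H → GridReach H V i₀ j₀ (i + 1) j → GridReach H V i₀ j₀ i j
  | up {i j : ℤ} : (i, j) ∈ V → GridReach H V i₀ j₀ i j → GridReach H V i₀ j₀ i (j + 1)
  | down {i j : ℤ} : (i, j) ∈ V → GridReach H V i₀ j₀ i (j + 1) → GridReach H V i₀ j₀ i j

/-- A square of the grid, named by its lower left corner, *escapes* if it can be joined to the rows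
of height at least `M` by crossing only horizontal edges outside `H` and vertical edges
outside `V`. This is phrased as an induction principle. -/
def GridEscapes (M : ℤ) (H V : Set (ℤ × ℤ)) (i j : ℤ) : Prop :=
  ∀ P : ℤ → ℤ → Prop, (∀ i j, M ≤ j → P i j) → (∀ i j, (i, j) ∉ H → (P i j ↔ P i (j - 1))) →
    (∀ i j, (i, j) ∉ V → (P i j ↔ P (i - 1) j)) → P i j

/-- The winding number of a walk in the grid, as a function on the squares. -/
theorem GridReach.exists_winding {M : ℤ} {H V : Finset (ℤ × ℤ)} (hM : ∀ p ∈ H, p.2 ≤ M)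
    {i₀ j₀ i₁ j₁ : ℤ} (h : GridReach H V i₀ j₀ i₁ j₁) :
    ∃ N : ℤ → ℤ → ℤ, (∀ i j, M ≤ j → N i j = 0) ∧ (∀ i j, (i, j) ∉ H → N i j = N i (j - 1)) ∧
      ∀ i j, (i, j) ∉ V → N i j - N (i - 1) j =
        (if i₀ = i ∧ j < j₀ then 1 else 0) - (if i₁ = i ∧ j < j₁ then 1 else 0) := by
  induction h with
  | refl => exact ⟨fun _ _ => 0, by simp⟩
  | @right k l hk _ ih =>
    obtain ⟨N, h1, h2, h3⟩ := ih
    refine ⟨fun i j => N i j + if i = k ∧ j < l then 1 else 0, ?_, ?_, ?_⟩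
    · intro i j hj
      have := hM _ hk
      grind
    · intro i j hij
      have := h2 i j hij
      have : (i, j) ≠ (k, l) := fun h => hij (h ▸ hk)
      grind
    · intro i j hij
      have := h3 i j hij
      grind
  | @left k l hk _ ih =>
    obtain ⟨N, h1, h2, h3⟩ := ih
    refine ⟨fun i j => N i j - if i = k ∧ j < l then 1 else 0, ?_, ?_, ?_⟩
    · intro i j hj
      have := hM _ hk
      grind
    · intro i j hij
      have := h2 i j hij
      have : (i, j) ≠ (k, l) := fun h => hij (h ▸ hk)
      grind
    · intro i j hij
      have := h3 i j hij
      grind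
  | @up k l hk _ ih =>
    obtain ⟨N, h1, h2, h3⟩ := ih
    refine ⟨N, h1, h2, fun i j hij => ?_⟩
    have := h3 i j hij
    have : (i, j) ≠ (k, l) := fun h => hij (h ▸ hk)
    grind
  | @down k l hk _ ih =>
    obtain ⟨N, h1, h2, h3⟩ := ih
    refine ⟨N, h1, h2, fun i j hij => ?_⟩
    have := h3 i j hij
    have : (i, j) ≠ (k, l) := fun h => hij (h ▸ hk)
    grind

/-- If every square escapes, then each horizontal edge is a bridge. -/
theorem not_gridReach_erase_horizontal {M : ℤ} {H V : Finset (ℤ × ℤ)} (hM : ∀ p ∈ H, p.2 ≤ M)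
    (hesc : ∀ i j, GridEscapes M H V i j) {k l : ℤ} (hk : (k, l) ∈ H) :
    ¬ GridReach (H.erase (k, l)) V (k + 1) l k l := by
  intro h
  obtain ⟨N, h1, h2, h3⟩ := h.exists_winding (M := M)
    (fun p hp => hM p (Finset.mem_of_mem_erase hp))
  have key : ∀ i j, N i j + (if i = k ∧ j < l then 1 else 0) = 0 := by
    intro i j
    apply hesc i j (fun i j => N i j + (if i = k ∧ j < l then 1 else 0) = 0)
    · intro i j hj
      have := hM _ hk
      grind
    · intro i j hij
      have hij' : (i, j) ∉ H := hij
      have := h2 i j (by simp [hij'])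
      have : (i, j) ≠ (k, l) := fun h => hij' (h ▸ hk)
      grind
    · intro i j hij
      have := h3 i j hij
      grind
  have e1 := h2 k l (by simp)
  have e2 := key k l
  have e3 := key k (l - 1)
  grind

/-- If every square escapes, then each vertical edge is a bridge. -/
theorem not_gridReach_erase_vertical {M : ℤ} {H V : Finset (ℤ × ℤ)} (hM : ∀ p ∈ H, p.2 ≤ M)
    (hesc : ∀ i j, GridEscapes M H V i j) {k l : ℤ} (hk : (k, l) ∈ V) :
    ¬ GridReach H (V.erase (k, l)) k (l + 1) k l := by
  intro h
  obtain ⟨N, h1, h2, h3⟩ := h.exists_winding hM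
  have key : ∀ i j, N i j = 0 := by
    intro i j
    apply hesc i j (fun i j => N i j = 0) h1
    · intro i j hij
      have := h2 i j hij
      grind
    · intro i j hij
      have hij' : (i, j) ∉ V := hij
      have := h3 i j (by simp [hij'])
      have : (i, j) ≠ (k, l) := fun h => hij' (h ▸ hk)
      grind
  have e1 := h3 k l (by simp)
  have e2 := key k l
  have e3 := key (k - 1) l
  grind

theorem GridEscapes.mono {M : ℤ} {H V H' V' : Set (ℤ × ℤ)} (hH : H' ⊆ H) (hV : V' ⊆ V) {i j : ℤ}
    (h : GridEscapes M H V i j) : GridEscapes M H' V' i j :=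
  fun P h1 h2 h3 => h P h1 (fun i j hij => h2 i j fun h' => hij (hH h'))
    (fun i j hij => h3 i j fun h' => hij (hV h'))

/-- `φ` is a potential for the group-valued weights `a` and `b` on the edges in `H` and `V`. -/
def IsGridPotential {G : Type*} [Group G] (a b : ℤ → ℤ → G) (H V : Finset (ℤ × ℤ))
    (φ : ℤ → ℤ → G) : Prop :=
  (∀ i j, (i, j) ∈ H → φ (i + 1) j = φ i j * a i j) ∧
    ∀ i j, (i, j) ∈ V → φ i (j + 1) = φ i j * b i j

/-- If every square escapes, the edges form a forest, and every group-valued weight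
has a potential. -/
theorem exists_isGridPotential_of_forall_gridEscapes {G : Type*} [Group G] (a b : ℤ → ℤ → G)
    {M : ℤ} (n : ℕ) (H V : Finset (ℤ × ℤ)) (hn : H.card + V.card = n) (hM : ∀ p ∈ H, p.2 ≤ M)
    (hesc : ∀ i j, GridEscapes M H V i j) : ∃ φ, IsGridPotential a b H V φ := by
  classical
  induction n generalizing H V with
  | zero =>
    have hH : H = ∅ := Finset.card_eq_zero.1 (by omega)
    have hV : V = ∅ := Finset.card_eq_zero.1 (by omega)
    exact ⟨fun _ _ => 1, by simp [IsGridPotential, hH, hV]⟩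
  | succ n ih =>
    rcases H.eq_empty_or_nonempty with rfl | ⟨⟨k, l⟩, hk⟩
    · rcases V.eq_empty_or_nonempty with rfl | ⟨⟨k, l⟩, hk⟩
      · simp at hn
      · have hbr := not_gridReach_erase_vertical hM hesc hk
        obtain ⟨φ, h1, h2⟩ := ih ∅ (V.erase (k, l))
          (by rw [Finset.card_erase_of_mem hk]; simp at hn ⊢; omega) hM
          (fun i j => (hesc i j).mono subset_rfl (by simp))
        refine ⟨fun i j => if GridReach ∅ (V.erase (k, l)) k (l + 1) i j then
          φ k l * b k l * (φ k (l + 1))⁻¹ * φ i j else φ i j, by simp, fun i j hij => ?_⟩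
        by_cases he : (i, j) = (k, l)
        · obtain ⟨rfl, rfl⟩ := Prod.ext_iff.1 he
          simp [hbr, GridReach.refl]
        · have hm : (i, j) ∈ V.erase (k, l) := Finset.mem_erase.2 ⟨he, hij⟩
          have hiff : GridReach ∅ (V.erase (k, l)) k (l + 1) i j ↔
            GridReach ∅ (V.erase (k, l)) k (l + 1) i (j + 1) := ⟨.up hm, .down hm⟩
          have := h2 i j hm
          simp only [← hiff, this]
          split_ifs <;> simp [mul_assoc]
    · have hbr := not_gridReach_erase_horizontal hM hesc hk
      obtain ⟨φ, h1, h2⟩ := ih (H.erase (k, l)) V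
        (by rw [Finset.card_erase_of_mem hk]; have := Finset.card_pos.2 ⟨_, hk⟩; omega)
        (fun p hp => hM p (Finset.mem_of_mem_erase hp))
        (fun i j => (hesc i j).mono (by simp) subset_rfl)
      refine ⟨fun i j => if GridReach (H.erase (k, l)) V (k + 1) l i j then
        φ k l * a k l * (φ (k + 1) l)⁻¹ * φ i j else φ i j, fun i j hij => ?_, fun i j hij => ?_⟩
      · by_cases he : (i, j) = (k, l)
        · obtain ⟨rfl, rfl⟩ := Prod.ext_iff.1 he
          simp [hbr, GridReach.refl]
        · have hm : (i, j) ∈ H.erase (k, l) := Finset.mem_erase.2 ⟨he, hij⟩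
          have hiff : GridReach (H.erase (k, l)) V (k + 1) l i j ↔
            GridReach (H.erase (k, l)) V (k + 1) l (i + 1) j := ⟨.right hm, .left hm⟩
          have := h1 i j hm
          simp only [← hiff, this]
          split_ifs <;> simp [mul_assoc]
      · have hiff : GridReach (H.erase (k, l)) V (k + 1) l i j ↔
          GridReach (H.erase (k, l)) V (k + 1) l i (j + 1) := ⟨.up hij, .down hij⟩
        have := h2 i j hij
        simp only [← hiff, this]
        split_ifs <;> simp [mul_assoc]

/-- A group-valued weight on the edges of a finite planar square complex whose complement is
connected, with trivial product around each square of the complex, has a potential. -/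
theorem exists_isGridPotential {G : Type*} [Group G] (a b : ℤ → ℤ → G)
    {M : ℤ} (n : ℕ) (F H V : Finset (ℤ × ℤ)) (hn : F.card = n) (hM : ∀ p ∈ H, p.2 ≤ M)
    (hrel : ∀ i j, (i, j) ∈ F → a i j * b (i + 1) j = b i j * a i (j + 1))
    (hbd : ∀ i j, (i, j) ∈ F → (i, j) ∈ H ∧ (i, j + 1) ∈ H ∧ (i, j) ∈ V ∧ (i + 1, j) ∈ V)
    (hesc : ∀ i j, (i, j) ∉ F → GridEscapes M H V i j) : ∃ φ, IsGridPotential a b H V φ := by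
  classical
  induction n generalizing F H with
  | zero =>
    obtain rfl : F = ∅ := Finset.card_eq_zero.1 hn
    exact exists_isGridPotential_of_forall_gridEscapes a b _ H V rfl hM (by simpa using hesc)
  | succ n ih =>
    obtain ⟨⟨k, l⟩, hk, hmax⟩ := F.exists_max_image Prod.snd (Finset.card_pos.1 (by omega))
    have htop : (k, l + 1) ∉ F := fun h => by simpa using hmax _ h
    obtain ⟨hb1, hb2, hb3, hb4⟩ := hbd k l hk
    obtain ⟨φ, h1, h2⟩ := ih (F.erase (k, l)) (H.erase (k, l + 1))
      (by rw [Finset.card_erase_of_mem hk]; omega)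
      (fun p hp => hM p (Finset.mem_of_mem_erase hp))
      (fun i j hij => hrel i j (Finset.mem_of_mem_erase hij))
      (fun i j hij => by
        obtain ⟨hne, hij⟩ := Finset.mem_erase.1 hij
        obtain ⟨c1, c2, c3, c4⟩ := hbd i j hij
        refine ⟨Finset.mem_erase.2 ⟨fun h => htop (h ▸ hij), c1⟩,
          Finset.mem_erase.2 ⟨fun h => hne ?_, c2⟩, c3, c4⟩
        simpa using h)
      (fun i j hij => by
        have hmono : ∀ i j, (i, j) ∉ F → GridEscapes M ↑(H.erase (k, l + 1)) V i j :=
          fun i j hij => (hesc i j hij).mono (by simp) subset_rfl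
        by_cases he : (i, j) = (k, l)
        · obtain ⟨rfl, rfl⟩ := Prod.ext_iff.1 he
          intro P p1 p2 p3
          have := (p2 i (j + 1) (by simp)).1 (hmono _ _ htop P p1 p2 p3)
          simpa using this
        · exact hmono i j fun h => hij (Finset.mem_erase.2 ⟨he, h⟩))
    refine ⟨φ, fun i j hij => ?_, h2⟩
    by_cases he : (i, j) = (k, l + 1)
    · obtain ⟨rfl, rfl⟩ : i = k ∧ j = l + 1 := by simpa using he
      have r := hrel i l hk
      have e1 := h1 i l (Finset.mem_erase.2 ⟨by simp, hb1⟩)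
      have e2 := h2 i l hb3
      have e3 := h2 (i + 1) l hb4
      rw [e3, e1, e2, mul_assoc, r, mul_assoc]
    · exact h1 i j (Finset.mem_erase.2 ⟨he, hij⟩)

/-- A group-valued transport along paths that is multiplicative, homotopy invariant and detects
null-homotopic loops. -/
structure PathTransport (X : Type*) [TopologicalSpace X] (G : Type*) [Group G] where
  toFun : ∀ {x y : X}, Path x y → G
  map_trans : ∀ {x y z : X} (p : Path x y) (q : Path y z), toFun (p.trans q) = toFun p * toFun q
  map_homotopic : ∀ {x y : X} {p q : Path x y}, p.Homotopic q → toFun p = toFun q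
  homotopic_refl : ∀ {x : X} {p : Path x x}, toFun p = 1 → p.Homotopic (.refl x)

namespace PathTransport

/-- Transport to a base point of a path connected space. -/
noncomputable def ofPathConnected (X : Type*) [TopologicalSpace X] [PathConnectedSpace X]
    (x₀ : X) : PathTransport X (FundamentalGroup X x₀)ᵐᵒᵖ :=
  let c (x : X) : Path.Homotopic.Quotient x₀ x := .mk (PathConnectedSpace.somePath x₀ x)
  { toFun := fun {x y} p => .op (((c x).trans (.mk p)).trans (c y).symm)
    map_trans := fun {x y z} p q => by
      rw [← MulOpposite.op_mul, FundamentalGroup.mul_def]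
      congr 1
      simp [Path.Homotopic.Quotient.mk_trans]
      grind
    map_homotopic := fun {x y p q} h => by
      rw [Path.Homotopic.Quotient.eq.2 h]
    homotopic_refl := fun {x p} h => by
      rw [← MulOpposite.op_one, MulOpposite.op_inj, FundamentalGroup.one_def] at h
      rw [← Path.Homotopic.Quotient.eq, Path.Homotopic.Quotient.mk_refl]
      have : Path.Homotopic.Quotient.mk p =
        ((c x).symm.trans (((c x).trans (.mk p)).trans (c x).symm)).trans (c x) := by
        simp
        grind
      rw [this, h]
      simp }

variable {X : Type*} [TopologicalSpace X] {G : Type*} [Group G] (ρ : PathTransport X G)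

theorem map_refl (x : X) : ρ.toFun (.refl x) = 1 := by
  have := ρ.map_trans (.refl x) (.refl x)
  rw [Path.refl_trans_refl] at this
  simpa using this

theorem map_cast {x y x' y' : X} (p : Path x y) (hx : x' = x) (hy : y' = y) :
    ρ.toFun (p.cast hx hy) = ρ.toFun p := by
  subst hx hy
  rfl

/-- A loop is null-homotopic if the transport along it has local potentials that fit together. -/
theorem homotopic_refl_of_potential {x : X} (p : Path x x) (Φ : X → G)
    (h : ∀ t, ∀ᶠ t' in 𝓝 t, Φ (p t') = Φ (p t) * ρ.toFun (p.subpath t t')) :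
    p.Homotopic (.refl x) := by
  apply ρ.homotopic_refl
  have hlc : IsLocallyConstant fun t => ρ.toFun (p.subpath 0 t) * (Φ (p t))⁻¹ := by
    rw [IsLocallyConstant.iff_eventually_eq]
    intro t
    filter_upwards [h t] with t' ht'
    rw [ht', ← ρ.map_homotopic ⟨Path.Homotopy.subpathTransSubpath p 0 t t'⟩, ρ.map_trans]
    group
  have := hlc.apply_eq_of_preconnectedSpace 0 1
  rw [Path.subpath_self, ρ.map_refl, Path.subpath_zero_one, ρ.map_cast, p.source, p.target] at this
  simpa using this.symm

end PathTransport

/-- Two paths in a set of complex numbers staying in the same convex subset are homotopic. -/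
theorem Path.homotopic_of_forall_mem_convex {Ω C : Set ℂ} (hC : Convex ℝ C) (hCΩ : C ⊆ Ω)
    {x y : Ω} (p q : Path x y) (hp : ∀ t, (p t : ℂ) ∈ C) (hq : ∀ t, (q t : ℂ) ∈ C) :
    p.Homotopic q := by
  have hne : C.Nonempty := ⟨_, hp 0⟩
  have := hC.contractibleSpace hne
  have hx : (x : ℂ) ∈ C := by simpa using hp 0
  have hy : (y : ℂ) ∈ C := by simpa using hp 1
  let lift (r : Path x y) (hr : ∀ t, (r t : ℂ) ∈ C) : Path (⟨x, hx⟩ : C) ⟨y, hy⟩ :=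
    { toFun := fun t => ⟨r t, hr t⟩
      continuous_toFun := by fun_prop
      source' := by simp
      target' := by simp }
  exact (SimplyConnectedSpace.paths_homotopic (lift p hp) (lift q hq)).map
    ⟨Set.inclusion hCΩ, continuous_inclusion hCΩ⟩

theorem exists_path_forall_mem_convex {Ω C : Set ℂ} (hC : Convex ℝ C) (hCΩ : C ⊆ Ω)
    {x y : Ω} (hx : (x : ℂ) ∈ C) (hy : (y : ℂ) ∈ C) : ∃ p : Path x y, ∀ t, (p t : ℂ) ∈ C := by
  obtain ⟨q, hq⟩ := (hC.isPathConnected ⟨_, hx⟩).joinedIn _ hx _ hy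
  exact ⟨{ toFun := fun t => ⟨q t, hCΩ (hq t)⟩
           continuous_toFun := by fun_prop
           source' := by simp
           target' := by simp }, hq⟩

/-- Transport along segments. -/
theorem PathTransport.exists_segment_transport {Ω : Set ℂ} {G : Type*} [Group G]
    (ρ : PathTransport Ω G) : ∃ d : ℂ → ℂ → G,
      (∀ C : Set ℂ, Convex ℝ C → C ⊆ Ω → ∀ (x y : Ω) (p : Path x y), (∀ t, (p t : ℂ) ∈ C) →
        ρ.toFun p = d x y) ∧
      ∀ z w, ¬ segment ℝ z w ⊆ Ω → d z w = 1 := by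
  classical
  have key : ∀ z w, segment ℝ z w ⊆ Ω → ∃ g : G, ∀ C : Set ℂ, Convex ℝ C → C ⊆ Ω →
      ∀ (x y : Ω) (p : Path x y), (x : ℂ) = z → (y : ℂ) = w → (∀ t, (p t : ℂ) ∈ C) →
        ρ.toFun p = g := by
    intro z w hzw
    obtain ⟨q, hq⟩ := exists_path_forall_mem_convex (convex_segment z w) hzw
      (x := ⟨z, hzw (left_mem_segment ..)⟩) (y := ⟨w, hzw (right_mem_segment ..)⟩)
      (left_mem_segment ..) (right_mem_segment ..)
    refine ⟨ρ.toFun q, ?_⟩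
    rintro C hC hCΩ ⟨x, hx⟩ ⟨y, hy⟩ p rfl rfl hp
    refine ρ.map_homotopic (Path.homotopic_of_forall_mem_convex hC hCΩ p q hp fun t => ?_)
    exact hC.segment_subset (by simpa using hp 0) (by simpa using hp 1) (hq t)
  refine ⟨fun z w => if h : segment ℝ z w ⊆ Ω then (key z w h).choose else 1, ?_, ?_⟩
  · intro C hC hCΩ x y p hp
    have h : segment ℝ (x : ℂ) y ⊆ Ω :=
      (hC.segment_subset (by simpa using hp 0) (by simpa using hp 1)).trans hCΩ
    simp only [h, dite_true]
    exact (key x y h).choose_spec C hC hCΩ x y p rfl rfl hp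
  · intro z w h
    simp [h]

/-- On an open set with simply connected components, every nonvanishing continuous function
has a continuous logarithm. -/
theorem exists_continuousOn_exp_eq_of_components {A : Set ℂ} (hA : IsOpen A)
    (h : ∀ z ∈ A, SimplyConnectedSpace (connectedComponentIn A z)) {g : ℂ → ℂ}
    (hg : ContinuousOn g A) (hg₀ : ∀ z ∈ A, g z ≠ 0) :
    ∃ L : ℂ → ℂ, ContinuousOn L A ∧ ∀ z ∈ A, Complex.exp (L z) = g z := by
  have key : ∀ C : Set ℂ, ∃ f : ℂ → ℂ, ∀ z ∈ A, C = connectedComponentIn A z →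
      ContinuousOn f C ∧ Set.EqOn (Complex.exp ∘ f) g C := by
    intro C
    by_cases hC : ∃ z ∈ A, C = connectedComponentIn A z
    · obtain ⟨z, hz, rfl⟩ := hC
      have hsub := connectedComponentIn_subset A z
      obtain ⟨f, hf⟩ := Complex.exists_continuousOn_eqOn_exp_comp
        (U := connectedComponentIn A z) (h z hz) hA.connectedComponentIn (hg.mono hsub)
        (by rintro ⟨w, hw, h0⟩; exact hg₀ w (hsub hw) h0)
      exact ⟨f, fun _ _ _ => hf⟩
    · exact ⟨0, fun z hz hCz => (hC ⟨z, hz, hCz⟩).elim⟩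
  choose f hf using key
  refine ⟨fun z => f (connectedComponentIn A z) z, fun z hz => ?_, fun z hz => ?_⟩
  · have hn : connectedComponentIn A z ∈ 𝓝 z :=
      hA.connectedComponentIn.mem_nhds (mem_connectedComponentIn hz)
    have hc : ContinuousAt (f (connectedComponentIn A z)) z :=
      (hf _ z hz rfl).1.continuousAt hn
    refine (hc.congr ?_).continuousWithinAt
    filter_upwards [hn] with w hw
    rw [connectedComponentIn_eq hw]
  · exact (hf _ z hz rfl).2 (mem_connectedComponentIn hz)

/-- A nonvanishing continuous function on the plane does not agree with `z ↦ z - a`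
near infinity. -/
theorem false_of_eq_sub_near_infty {g : ℂ → ℂ} (hg : Continuous g) (hg₀ : ∀ z, g z ≠ 0) {a : ℂ}
    (h : ∀ᶠ z in Filter.cocompact ℂ, g z = z - a) : False := by
  have hU : IsSimplyConnected (Set.univ : Set ℂ) := by
    have := (convex_univ (𝕜 := ℝ) (E := ℂ)).contractibleSpace ⟨0, trivial⟩
    exact SimplyConnectedSpace.ofContractible _
  obtain ⟨L, hLc, hL⟩ := Complex.exists_continuousOn_eqOn_exp_comp hU isOpen_univ
    hg.continuousOn (by rintro ⟨w, -, h0⟩; exact hg₀ w h0)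
  have hLc : Continuous L := continuousOn_univ.1 hLc
  rw [← Metric.cobounded_eq_cocompact, (Filter.hasBasis_cobounded_norm (E := ℂ)).eventually_iff] at h
  obtain ⟨R, -, hR⟩ := h
  set r : ℝ := |R| + ‖a‖ + 1 with hr
  have hr0 : 0 < r := by positivity
  let c : ℝ → ℂ := fun t => a + r * Complex.exp (t * Complex.I)
  have hcc : Continuous c := by fun_prop
  have hc : ∀ t, g (c t) = r * Complex.exp (t * Complex.I) := by
    intro t
    have hmem : c t ∈ {x : ℂ | R ≤ ‖x‖} := by
      have h1 : ‖(r : ℂ) * Complex.exp (t * Complex.I)‖ = r := by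
        rw [norm_mul, Complex.norm_exp_ofReal_mul_I, Complex.norm_real, Real.norm_of_nonneg hr0.le,
          mul_one]
      have h2 : ‖(r : ℂ) * Complex.exp (t * Complex.I)‖ ≤ ‖c t‖ + ‖a‖ := by
        have := norm_sub_le (c t) a
        simpa [c] using this
      have := le_abs_self R
      simp only [Set.mem_ofPred_eq]
      linarith
    rw [hR hmem]
    simp [c]
  let ψ : ℝ → ℂ := fun t => L (c t) - t * Complex.I
  have hψc : Continuous ψ := by fun_prop
  have hψ : ∀ t, Complex.exp (ψ t) = r := by
    intro t
    have : Complex.exp (L (c t)) = g (c t) := hL trivial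
    rw [Complex.exp_sub, this, hc]
    field_simp
  have hend : ψ (2 * Real.pi) = ψ 0 - 2 * Real.pi * Complex.I := by
    have : c (2 * Real.pi) = c 0 := by simp [c]
    simp [ψ, this]
  have hmc : Continuous fun t => (ψ t - ψ 0).im := by fun_prop
  have hivt := intermediate_value_Icc' (by positivity : (0 : ℝ) ≤ 2 * Real.pi) hmc.continuousOn
  have hpi := Real.pi_pos
  obtain ⟨t, -, ht⟩ := hivt (show -Real.pi ∈ _ by
    constructor
    · simp [hend]; linarith
    · simp; linarith)
  have h1 : Complex.exp (ψ t - ψ 0) = 1 := by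
    rw [Complex.exp_sub, hψ, hψ, div_self]
    exact_mod_cast hr0.ne'
  obtain ⟨n, hn⟩ := Complex.exp_eq_one_iff.1 h1
  have h2 : (n : ℝ) * (2 * Real.pi) = -Real.pi := by
    rw [← ht]
    simp [hn]
  have h3 : (2 * n + 1 : ℝ) = 0 := by
    have : (2 * n + 1 : ℝ) * Real.pi = 0 := by linarith
    exact (mul_eq_zero.1 this).resolve_right hpi.ne'
  have h4 : (2 * n + 1 : ℤ) = 0 := by exact_mod_cast h3
  omega

/-- If the components of `A` are simply connected, then no part of the complement splits off
from the point at infinity. -/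
theorem subset_of_infty_mem_of_isClosed {A : Set ℂ} (hA : IsOpen A)
    (h : ∀ z ∈ A, SimplyConnectedSpace (connectedComponentIn A z)) {S T : Set (OnePoint ℂ)}
    (hS : IsClosed S) (hT : IsClosed T) (hST : Disjoint S T) (hinf : ∞ ∈ T)
    (hcov : ((↑) '' A : Set (OnePoint ℂ))ᶜ ⊆ S ∪ T)
    (hSA : S ⊆ ((↑) '' A : Set (OnePoint ℂ))ᶜ) : S = ∅ := by
  by_contra hne
  obtain ⟨a, ha⟩ := Set.nonempty_iff_ne_empty.2 hne
  induction a using OnePoint.rec with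
  | infty => exact Set.disjoint_left.1 hST ha hinf
  | coe a =>
  have haA : a ∉ A := fun h' => hSA ha ⟨a, h', rfl⟩
  obtain ⟨L, hLc, hL⟩ := exists_continuousOn_exp_eq_of_components hA h (g := fun z => z - a)
    (by fun_prop) (fun z hz => sub_ne_zero.2 fun h' => haA (h' ▸ hz))
  obtain ⟨f, hf0, hf1, -⟩ := exists_continuous_zero_one_of_isClosed hS hT hST
  have hfc : Continuous fun z : ℂ => f z := f.continuous.comp OnePoint.continuous_coe
  have hmem : ∀ z : ℂ, f z ≠ 0 → f z ≠ 1 → z ∈ A := by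
    intro z h0 h1
    by_contra hz
    rcases hcov (show (z : OnePoint ℂ) ∈ _ from by simpa using hz) with h' | h'
    · exact h0 (hf0 h')
    · exact h1 (hf1 h')
  let φ : ℂ → ℝ := fun z => max 0 (min 1 (3 * f z - 1))
  have hφc : Continuous φ :=
    continuous_const.max (continuous_const.min ((continuous_const.mul hfc).sub continuous_const))
  let g : ℂ → ℂ := fun z =>
    if f z < 1 / 3 then 1 else if 2 / 3 < f z then z - a else Complex.exp (φ z * L z)
  have hgA : ∀ z ∈ A, g z = Complex.exp (φ z * L z) := by
    intro z hz
    simp only [g]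
    split_ifs with h1 h2
    · have : φ z = 0 := max_eq_left ((min_le_right _ _).trans (by linarith))
      simp [this]
    · have : φ z = 1 := by
        simp only [φ]
        rw [min_eq_left (by linarith), max_eq_right zero_le_one]
      simp [this, hL z hz]
    · rfl
  refine false_of_eq_sub_near_infty (g := g) (a := a) ?_ ?_ ?_
  · rw [continuous_iff_continuousAt]
    intro z
    rcases lt_or_ge (f z) (1 / 3) with h1 | h1
    · refine continuousAt_const.congr (f := fun _ => (1 : ℂ)) ?_
      filter_upwards [hfc.continuousAt.eventually_lt continuousAt_const h1] with w hw
      simp only [g, if_pos hw]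
    · rcases lt_or_ge (2 / 3) (f z) with h2 | h2
      · refine ContinuousAt.congr (f := fun w => w - a) (by fun_prop) ?_
        filter_upwards [continuousAt_const.eventually_lt hfc.continuousAt h2] with w hw
        have : ¬ f w < 1 / 3 := by linarith
        simp only [g, if_neg this, if_pos hw]
      · have hz : z ∈ A := hmem z (by linarith) (by linarith)
        have hLz : ContinuousAt L z := hLc.continuousAt (hA.mem_nhds hz)
        refine ContinuousAt.congr (f := fun w => Complex.exp (φ w * L w)) ?_ ?_
        · have : ContinuousAt φ z := hφc.continuousAt
          fun_prop
        · filter_upwards [hA.mem_nhds hz] with w hw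
          exact (hgA w hw).symm
  · intro z
    simp only [g]
    split_ifs with h1 h2
    · exact one_ne_zero
    · rw [sub_ne_zero]
      rintro rfl
      rw [hf0 ha] at h2
      norm_num at h2
    · exact Complex.exp_ne_zero _
  · have h1 : ∀ᶠ x in 𝓝 (∞ : OnePoint ℂ), 2 / 3 < f x :=
      continuousAt_const.eventually_lt f.continuous.continuousAt (by rw [hf1 hinf]; norm_num)
    have h2 : ∀ᶠ z : ℂ in Filter.coclosedCompact ℂ, 2 / 3 < f z :=
      OnePoint.tendsto_coe_infty.eventually h1
    rw [Filter.coclosedCompact_eq_cocompact] at h2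
    filter_upwards [h2] with z hz
    have : ¬ f z < 1 / 3 := by linarith
    simp only [g, if_neg this, if_pos hz]

theorem isConnected_compl_of_components {A : Set ℂ} (hA : IsOpen A)
    (h : ∀ z ∈ A, SimplyConnectedSpace (connectedComponentIn A z)) :
    IsConnected (((↑) '' A : Set (OnePoint ℂ))ᶜ) := by
  have hK : IsClosed (((↑) '' A : Set (OnePoint ℂ))ᶜ) :=
    (OnePoint.isOpenEmbedding_coe.isOpenMap A hA).isClosed_compl
  have hinf : (∞ : OnePoint ℂ) ∈ ((↑) '' A : Set (OnePoint ℂ))ᶜ := by simp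
  refine ⟨⟨∞, hinf⟩, isPreconnected_iff_subset_of_disjoint_closed.2 fun u v hu hv hcov hdisj => ?_⟩
  have aux : ∀ u v : Set (OnePoint ℂ), IsClosed u → IsClosed v →
      ((↑) '' A : Set (OnePoint ℂ))ᶜ ⊆ u ∪ v →
      ((↑) '' A : Set (OnePoint ℂ))ᶜ ∩ (u ∩ v) = ∅ → ∞ ∈ v →
      ((↑) '' A : Set (OnePoint ℂ))ᶜ ⊆ v := by
    intro u v hu hv hcov hdisj hiv
    have := subset_of_infty_mem_of_isClosed hA h (hu.inter hK) (hv.inter hK)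
      (by
        rw [Set.disjoint_iff_inter_eq_empty, ← hdisj]
        ext x
        simp only [Set.mem_inter_iff]
        tauto) ⟨hiv, hinf⟩
      (fun x hx => (hcov hx).imp (fun h => ⟨h, hx⟩) fun h => ⟨h, hx⟩) Set.inter_subset_right
    intro x hx
    refine (hcov hx).resolve_left fun hxu => ?_
    exact (this ▸ (⟨hxu, hx⟩ : x ∈ u ∩ _) : x ∈ (∅ : Set (OnePoint ℂ)))
  rcases hcov hinf with hi | hi
  · exact .inl (aux v u hv hu (by rwa [Set.union_comm]) (by rwa [Set.inter_comm v u]) hi)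
  · exact .inr (aux u v hu hv hcov hdisj hi)

/-- The closed square of side `δ` in the plane with lower left corner `δ (i + j I)`. -/
def gridSquare (δ : ℝ) (i j : ℤ) : Set ℂ :=
  {z | (i ≤ z.re / δ ∧ z.re / δ ≤ i + 1) ∧ j ≤ z.im / δ ∧ z.im / δ ≤ j + 1}

theorem mem_gridSquare {δ : ℝ} {i j : ℤ} {z : ℂ} : z ∈ gridSquare δ i j ↔
    (i ≤ z.re / δ ∧ z.re / δ ≤ i + 1) ∧ j ≤ z.im / δ ∧ z.im / δ ≤ j + 1 :=
  Iff.rfl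

theorem gridSquare_eq_reProdIm {δ : ℝ} (hδ : 0 < δ) (i j : ℤ) :
    gridSquare δ i j = Set.Icc (i * δ) ((i + 1) * δ) ×ℂ Set.Icc (j * δ) ((j + 1) * δ) := by
  ext z
  simp only [mem_gridSquare, Complex.mem_reProdIm, Set.mem_Icc, le_div_iff₀ hδ, div_le_iff₀ hδ]

theorem convex_gridSquare {δ : ℝ} (hδ : 0 < δ) (i j : ℤ) : Convex ℝ (gridSquare δ i j) := by
  rw [gridSquare_eq_reProdIm hδ]
  exact ((convex_Icc _ _).linear_preimage Complex.reLm).inter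
    ((convex_Icc _ _).linear_preimage Complex.imLm)

theorem isCompact_gridSquare {δ : ℝ} (hδ : 0 < δ) (i j : ℤ) : IsCompact (gridSquare δ i j) := by
  rw [gridSquare_eq_reProdIm hδ]
  exact isCompact_Icc.reProdIm isCompact_Icc

/-- The vertex `δ (i + j I)` of the grid. -/
def gridPoint (δ : ℝ) (i j : ℤ) : ℂ := ⟨δ * i, δ * j⟩

theorem gridPoint_mem_gridSquare {δ : ℝ} (hδ : 0 < δ) {i j k l : ℤ} (hi : k = i ∨ k = i + 1)
    (hj : l = j ∨ l = j + 1) : gridPoint δ k l ∈ gridSquare δ i j := by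
  have h1 : (gridPoint δ k l).re / δ = k := by simp [gridPoint, hδ.ne']
  have h2 : (gridPoint δ k l).im / δ = l := by simp [gridPoint, hδ.ne']
  rw [mem_gridSquare, h1, h2]
  rcases hi with rfl | rfl <;> rcases hj with rfl | rfl <;> simp

theorem mem_gridSquare_floor (δ : ℝ) (z : ℂ) :
    z ∈ gridSquare δ ⌊z.re / δ⌋ ⌊z.im / δ⌋ :=
  ⟨⟨Int.floor_le _, (Int.lt_floor_add_one _).le⟩, Int.floor_le _, (Int.lt_floor_add_one _).le⟩

/-- Squares containing points close to `z` contain `z`. -/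
theorem eventually_mem_gridSquare_floor (δ : ℝ) (z : ℂ) :
    ∀ᶠ w : ℂ in 𝓝 z, z ∈ gridSquare δ ⌊w.re / δ⌋ ⌊w.im / δ⌋ := by
  have aux : ∀ x : ℝ, ∀ᶠ y in 𝓝 x, (⌊y⌋ : ℝ) ≤ x ∧ x ≤ ⌊y⌋ + 1 := by
    intro x
    have h1 : x < ⌊x⌋ + 1 := Int.lt_floor_add_one x
    have h2 : (⌈x⌉ : ℝ) - 1 < x := by linarith [Int.ceil_lt_add_one x]
    filter_upwards [Iio_mem_nhds h1, Ioi_mem_nhds h2] with y hy1 hy2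
    have hy1 : y < ⌊x⌋ + 1 := hy1
    have hy2 : (⌈x⌉ : ℝ) - 1 < y := hy2
    constructor
    · have : ⌊y⌋ < ⌊x⌋ + 1 := Int.floor_lt.2 (by push_cast; exact hy1)
      exact (Int.cast_le.2 (by omega : ⌊y⌋ ≤ ⌊x⌋)).trans (Int.floor_le x)
    · have h3 : ((⌈x⌉ - 1 : ℤ) : ℝ) < ((⌊y⌋ + 1 : ℤ) : ℝ) := by
        push_cast
        linarith [Int.lt_floor_add_one y]
      have h4 : ⌈x⌉ ≤ ⌊y⌋ + 1 := by have := Int.cast_lt.1 h3; omega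
      exact (Int.le_ceil x).trans (by exact_mod_cast h4)
  have hre : Filter.Tendsto (fun w : ℂ => w.re / δ) (𝓝 z) (𝓝 (z.re / δ)) :=
    (Complex.continuous_re.div_const δ).continuousAt
  have him : Filter.Tendsto (fun w : ℂ => w.im / δ) (𝓝 z) (𝓝 (z.im / δ)) :=
    (Complex.continuous_im.div_const δ).continuousAt
  filter_upwards [hre.eventually (aux _), him.eventually (aux _)] with w h1 h2
  exact ⟨h1, h2⟩

/-- A property of squares that is invariant under passing to a neighbouring square containing `z`
holds for all or none of the squares containing `z`. -/
theorem gridSquare_induction {δ : ℝ} {z : ℂ} {P : ℤ → ℤ → Prop}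
    (hh : ∀ i j, z ∈ gridSquare δ i j → z ∈ gridSquare δ (i - 1) j → (P i j ↔ P (i - 1) j))
    (hv : ∀ i j, z ∈ gridSquare δ i j → z ∈ gridSquare δ i (j - 1) → (P i j ↔ P i (j - 1)))
    {i j k l : ℤ} (h : z ∈ gridSquare δ i j) (h' : z ∈ gridSquare δ k l) : P i j ↔ P k l := by
  have hm : z ∈ gridSquare δ k j := ⟨h'.1, h.2⟩
  have close : ∀ {m n : ℤ} {x : ℝ}, (m ≤ x ∧ x ≤ m + 1) → (n ≤ x ∧ x ≤ n + 1) →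
      n = m - 1 ∨ n = m ∨ m = n - 1 := by
    intro m n x h1 h2
    have h3 : (m : ℝ) ≤ ((n + 1 : ℤ) : ℝ) := by push_cast; linarith
    have h4 : (n : ℝ) ≤ ((m + 1 : ℤ) : ℝ) := by push_cast; linarith
    have h5 := Int.cast_le.1 h3
    have h6 := Int.cast_le.1 h4
    omega
  have e1 : P i j ↔ P k j := by
    rcases close h.1 h'.1 with rfl | rfl | rfl
    · exact hh _ _ h hm
    · rfl
    · exact (hh _ _ hm h).symm
  have e2 : P k j ↔ P k l := by
    rcases close h.2 h'.2 with rfl | rfl | rfl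
    · exact hv _ _ hm h'
    · rfl
    · exact (hv _ _ h' hm).symm
  exact e1.trans e2

theorem norm_sub_le_of_mem_gridSquare {δ : ℝ} (hδ : 0 < δ) {i j : ℤ} {z w : ℂ}
    (hz : z ∈ gridSquare δ i j) (hw : w ∈ gridSquare δ i j) : ‖z - w‖ ≤ 2 * δ := by
  rw [gridSquare_eq_reProdIm hδ, Complex.mem_reProdIm] at hz hw
  obtain ⟨⟨a1, a2⟩, a3, a4⟩ := hz
  obtain ⟨⟨b1, b2⟩, b3, b4⟩ := hw
  refine (Complex.norm_le_abs_re_add_abs_im _).trans ?_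
  have h1 : |(z - w).re| ≤ δ := by
    rw [Complex.sub_re, abs_le]; constructor <;> linarith
  have h2 : |(z - w).im| ≤ δ := by
    rw [Complex.sub_im, abs_le]; constructor <;> linarith
  linarith

/-- Horizontal edges of a set of squares. -/
def gridH (S : Set (ℤ × ℤ)) : Set (ℤ × ℤ) := {p | p ∈ S ∨ (p.1, p.2 - 1) ∈ S}

/-- Vertical edges of a set of squares. -/
def gridV (S : Set (ℤ × ℤ)) : Set (ℤ × ℤ) := {p | p ∈ S ∨ (p.1 - 1, p.2) ∈ S}

theorem notMem_gridH {S : Set (ℤ × ℤ)} {i j : ℤ} :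
    (i, j) ∉ gridH S ↔ (i, j) ∉ S ∧ (i, j - 1) ∉ S := not_or

theorem notMem_gridV {S : Set (ℤ × ℤ)} {i j : ℤ} :
    (i, j) ∉ gridV S ↔ (i, j) ∉ S ∧ (i - 1, j) ∉ S := not_or

theorem gridEscapes_iff_down {M : ℤ} {H V : Set (ℤ × ℤ)} {i j : ℤ} (h : (i, j) ∉ H) :
    GridEscapes M H V i j ↔ GridEscapes M H V i (j - 1) :=
  ⟨fun hE P h1 h2 h3 => (h2 i j h).1 (hE P h1 h2 h3),
    fun hE P h1 h2 h3 => (h2 i j h).2 (hE P h1 h2 h3)⟩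

theorem gridEscapes_iff_left {M : ℤ} {H V : Set (ℤ × ℤ)} {i j : ℤ} (h : (i, j) ∉ V) :
    GridEscapes M H V i j ↔ GridEscapes M H V (i - 1) j :=
  ⟨fun hE P h1 h2 h3 => (h3 i j h).1 (hE P h1 h2 h3),
    fun hE P h1 h2 h3 => (h3 i j h).2 (hE P h1 h2 h3)⟩

/-- The squares enclosed by a set of squares: those that cannot escape from it. -/
def gridFill (M : ℤ) (S : Set (ℤ × ℤ)) : Set (ℤ × ℤ) :=
  {p | ¬ GridEscapes M (gridH S) (gridV S) p.1 p.2}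

theorem mem_gridFill_iff_down {M : ℤ} {S : Set (ℤ × ℤ)} {i j : ℤ} (h : (i, j) ∉ gridH S) :
    (i, j) ∈ gridFill M S ↔ (i, j - 1) ∈ gridFill M S :=
  not_congr (gridEscapes_iff_down h)

theorem mem_gridFill_iff_left {M : ℤ} {S : Set (ℤ × ℤ)} {i j : ℤ} (h : (i, j) ∉ gridV S) :
    (i, j) ∈ gridFill M S ↔ (i - 1, j) ∈ gridFill M S :=
  not_congr (gridEscapes_iff_left h)

theorem subset_gridFill {M : ℤ} {S : Set (ℤ × ℤ)} (hM : ∀ p ∈ S, p.2 < M) : S ⊆ gridFill M S := by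
  rintro ⟨i, j⟩ hij hE
  refine hE (fun i j => (i, j) ∉ S) (fun i j hj h => ?_) (fun i j h => ?_) (fun i j h => ?_) hij
  · exact absurd (hM _ h) (not_lt.2 hj)
  · have := notMem_gridH.1 h
    simp [this]
  · have := notMem_gridV.1 h
    simp [this]

theorem gridEscapes_of_notMem_gridFill {M : ℤ} {S : Set (ℤ × ℤ)} {i j : ℤ}
    (h : (i, j) ∉ gridFill M S) :
    GridEscapes M (gridH (gridFill M S)) (gridV (gridFill M S)) i j := by
  intro P h1 h2 h3
  have hE : GridEscapes M (gridH S) (gridV S) i j := not_not.1 h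
  refine (hE (fun i j => (i, j) ∈ gridFill M S ∨ P i j) (fun i j hj => .inr (h1 i j hj))
    (fun i j hij => ?_) (fun i j hij => ?_)).resolve_left h
  · have e := mem_gridFill_iff_down (M := M) hij
    by_cases hF : (i, j) ∈ gridFill M S
    · simp [hF, e.1 hF]
    · have hF' : (i, j - 1) ∉ gridFill M S := fun h => hF (e.2 h)
      simp only [hF, hF', false_or]
      exact h2 i j (notMem_gridH.2 ⟨hF, hF'⟩)
  · have e := mem_gridFill_iff_left (M := M) hij
    by_cases hF : (i, j) ∈ gridFill M S
    · simp [hF, e.1 hF]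
    · have hF' : (i - 1, j) ∉ gridFill M S := fun h => hF (e.2 h)
      simp only [hF, hF', false_or]
      exact h3 i j (notMem_gridV.2 ⟨hF, hF'⟩)

theorem Int.iff_of_forall_iff_sub_one {Q : ℤ → Prop} (h : ∀ i, Q i ↔ Q (i - 1)) (i k : ℤ) :
    Q i ↔ Q k := by
  have aux : ∀ i, Q i ↔ Q 0 := by
    intro i
    induction i using Int.induction_on with
    | zero => rfl
    | succ n ih => rw [h, add_sub_cancel_right, ih]
    | pred n ih => rw [← h, ih]
  rw [aux i, aux k]

theorem finite_gridFill {M : ℤ} {S : Set (ℤ × ℤ)} (hM : ∀ p ∈ S, |p.1| < M ∧ |p.2| < M) :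
    (gridFill M S).Finite := by
  have col : ∀ i j, M ≤ |i| → GridEscapes M (gridH S) (gridV S) i j := by
    intro i j hi P h1 h2 h3
    have hS : ∀ j, (i, j) ∉ S := fun j h => absurd (hM _ h).1 (not_lt.2 hi)
    exact (Int.iff_of_forall_iff_sub_one
      (fun j => h2 i j (notMem_gridH.2 ⟨hS _, hS _⟩)) j M).2 (h1 i M le_rfl)
  have row : ∀ i j, M ≤ |j| → GridEscapes M (gridH S) (gridV S) i j := by
    intro i j hj P h1 h2 h3
    have hS : ∀ i, (i, j) ∉ S := fun i h => absurd (hM _ h).2 (not_lt.2 hj)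
    exact (Int.iff_of_forall_iff_sub_one (Q := fun i => P i j)
      (fun i => h3 i j (notMem_gridV.2 ⟨hS _, hS _⟩)) i M).2 (col M j (le_abs_self M) P h1 h2 h3)
  refine ((Set.finite_Icc (-M) M).prod (Set.finite_Icc (-M) M)).subset ?_
  rintro ⟨i, j⟩ hij
  have h1 : |i| < M := not_le.1 fun h => hij (col i j h)
  have h2 : |j| < M := not_le.1 fun h => hij (row i j h)
  rw [abs_lt] at h1 h2
  exact ⟨⟨h1.1.le, h1.2.le⟩, h2.1.le, h2.2.le⟩

/-- If `ℂ∞ \ A` is connected, then squares enclosed by squares contained in `A` are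
contained in `A`. -/
theorem gridSquare_subset_of_mem_gridFill {A : Set ℂ}
    (hK : IsConnected (((↑) '' A : Set (OnePoint ℂ))ᶜ)) {δ : ℝ} (hδ : 0 < δ) {M : ℤ}
    {S : Set (ℤ × ℤ)} (hM : ∀ p ∈ S, |p.1| < M ∧ |p.2| < M)
    (hS : ∀ p ∈ S, gridSquare δ p.1 p.2 ⊆ A) :
    ∀ p ∈ gridFill M S, gridSquare δ p.1 p.2 ⊆ A := by
  set Y : Set ℂ := ⋃ p ∈ gridFill M S, gridSquare δ p.1 p.2 with hY
  have hYc : IsCompact Y := (finite_gridFill hM).isCompact_biUnion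
    fun p _ => isCompact_gridSquare hδ p.1 p.2
  have hint : ∀ z ∉ A, z ∈ Y → z ∈ interior Y := by
    intro z hzA hzY
    obtain ⟨⟨i, j⟩, hp, hz⟩ := Set.mem_iUnion₂.1 hzY
    rw [mem_interior_iff_mem_nhds]
    filter_upwards [eventually_mem_gridSquare_floor δ z] with w hw
    have hnot : ∀ {i j}, z ∈ gridSquare δ i j → (i, j) ∉ S := fun h h' => hzA (hS _ h' h)
    have := gridSquare_induction (P := fun i j => (i, j) ∈ gridFill M S)
      (fun i j h h' => mem_gridFill_iff_left (notMem_gridV.2 ⟨hnot h, hnot h'⟩))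
      (fun i j h h' => mem_gridFill_iff_down (notMem_gridH.2 ⟨hnot h, hnot h'⟩)) hz hw
    exact Set.mem_iUnion₂.2 ⟨_, this.1 hp, mem_gridSquare_floor δ w⟩
  have hsub : ((↑) '' A : Set (OnePoint ℂ))ᶜ ⊆ ((↑) '' Y : Set (OnePoint ℂ))ᶜ := by
    refine hK.isPreconnected.subset_left_of_subset_union
      (v := ((↑) '' interior Y : Set (OnePoint ℂ)))
      (hYc.image OnePoint.continuous_coe).isClosed.isOpen_compl
      (OnePoint.isOpenEmbedding_coe.isOpenMap _ isOpen_interior)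
      (Set.disjoint_compl_left_iff_subset.2 (Set.image_mono interior_subset))
      (fun x hx => ?_) ⟨∞, by simp, by simp⟩
    by_cases hxY : x ∈ ((↑) '' Y : Set (OnePoint ℂ))
    · obtain ⟨z, hz, rfl⟩ := hxY
      exact .inr ⟨z, hint z (fun h => hx ⟨z, h, rfl⟩) hz, rfl⟩
    · exact .inl hxY
  intro p hp z hz
  by_contra hzA
  refine hsub (show (z : OnePoint ℂ) ∈ _ by simpa using hzA) ⟨z, ?_, rfl⟩
  exact Set.mem_iUnion₂.2 ⟨p, hp, hz⟩

/-- Transport along segments is a cocycle on convex subsets of `A`. -/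
theorem PathTransport.exists_segment_cocycle {A : Set ℂ} {z₀ : ℂ} {G : Type*}
    [Group G] (ρ : PathTransport (connectedComponentIn A z₀) G) : ∃ d : ℂ → ℂ → G,
      (∀ C : Set ℂ, Convex ℝ C → C ⊆ connectedComponentIn A z₀ →
        ∀ (x y : connectedComponentIn A z₀) (p : Path x y), (∀ t, (p t : ℂ) ∈ C) →
          ρ.toFun p = d x y) ∧
      ∀ C : Set ℂ, Convex ℝ C → C ⊆ A → ∀ x ∈ C, ∀ y ∈ C, ∀ z ∈ C, d x y * d y z = d x z := by
  obtain ⟨d, h1, h2⟩ := ρ.exists_segment_transport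
  refine ⟨d, h1, fun C hC hCA x hx y hy z hz => ?_⟩
  by_cases hsub : C ⊆ connectedComponentIn A z₀
  · obtain ⟨p, hp⟩ := exists_path_forall_mem_convex hC hsub (x := ⟨x, hsub hx⟩)
      (y := ⟨y, hsub hy⟩) hx hy
    obtain ⟨q, hq⟩ := exists_path_forall_mem_convex hC hsub (x := ⟨y, hsub hy⟩)
      (y := ⟨z, hsub hz⟩) hy hz
    have hpq : ∀ t, ((p.trans q) t : ℂ) ∈ C := by
      intro t
      rw [Path.trans_apply]
      split_ifs
      · exact hp _
      · exact hq _
    rw [← h1 C hC hsub _ _ p hp, ← h1 C hC hsub _ _ q hq, ← ρ.map_trans,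
      h1 C hC hsub _ _ _ hpq]
  · have hd : ∀ w ∈ C, w ∉ connectedComponentIn A z₀ := by
      intro w hw hwΩ
      apply hsub
      rw [connectedComponentIn_eq hwΩ]
      exact hC.isPreconnected.subset_connectedComponentIn hw hCA
    have h3 : ∀ u ∈ C, ∀ v, d u v = 1 := fun u hu v =>
      h2 u v fun h => hd u hu (h (left_mem_segment ℝ u v))
    rw [h3 x hx, h3 y hy, h3 x hx, mul_one]

/-- A compact subset of `A` is covered by finitely many small squares contained in `A`. -/
theorem exists_gridSquare_subset {A R : Set ℂ} (hA : IsOpen A) (hR : IsCompact R) (hRA : R ⊆ A) :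
    ∃ δ : ℝ, 0 < δ ∧ ∃ M : ℤ, ∀ i j, (gridSquare δ i j ∩ R).Nonempty →
      (|i| < M ∧ |j| < M) ∧ gridSquare δ i j ⊆ A := by
  obtain ⟨ε, hε, hεA⟩ := hR.exists_cthickening_subset_open hA hRA
  obtain ⟨B, hB⟩ := hR.isBounded.exists_norm_le
  refine ⟨ε / 2, by positivity, ⌈|B| / (ε / 2)⌉ + 2, ?_⟩
  rintro i j ⟨z, hz, hzR⟩
  have hbound : ∀ {x : ℝ} {n : ℤ}, |x| ≤ ‖z‖ → (n ≤ x / (ε / 2) ∧ x / (ε / 2) ≤ n + 1) →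
      |n| < ⌈|B| / (ε / 2)⌉ + 2 := by
    intro x n hx hn
    have h1 : |x / (ε / 2)| ≤ |B| / (ε / 2) := by
      rw [abs_div, abs_of_pos (by positivity : 0 < ε / 2)]
      exact div_le_div_of_nonneg_right (hx.trans ((hB z hzR).trans (le_abs_self B)))
        (by positivity)
    have h2 := Int.le_ceil (|B| / (ε / 2))
    obtain ⟨h3, h4⟩ := abs_le.1 h1
    have h5 : (|n| : ℝ) < ⌈|B| / (ε / 2)⌉ + 2 := by
      rw [abs_lt]
      constructor <;> linarith [hn.1, hn.2]
    exact_mod_cast h5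
  refine ⟨⟨hbound (Complex.abs_re_le_norm z) hz.1, hbound (Complex.abs_im_le_norm z) hz.2⟩, ?_⟩
  intro w hw
  refine hεA (Metric.mem_cthickening_of_dist_le w z ε R hzR ?_)
  rw [dist_eq_norm]
  have := norm_sub_le_of_mem_gridSquare (by positivity) hw hz
  linarith

/-- If `ℂ∞ \ A` is connected, the segment transport of a component has a potential on the squares
meeting a compact subset of `A`. -/
theorem exists_gridPotential_of_isConnected_compl {A : Set ℂ}
    (hK : IsConnected (((↑) '' A : Set (OnePoint ℂ))ᶜ)) {δ : ℝ} (hδ : 0 < δ) {M : ℤ}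
    {S : Set (ℤ × ℤ)} (hM : ∀ p ∈ S, |p.1| < M ∧ |p.2| < M)
    (hS : ∀ p ∈ S, gridSquare δ p.1 p.2 ⊆ A) {G : Type*} [Group G] {d : ℂ → ℂ → G}
    (hd : ∀ C : Set ℂ, Convex ℝ C → C ⊆ A → ∀ x ∈ C, ∀ y ∈ C, ∀ z ∈ C, d x y * d y z = d x z) :
    ∃ φ : ℤ → ℤ → G, ∀ i j, (i, j) ∈ S →
      φ (i + 1) j = φ i j * d (gridPoint δ i j) (gridPoint δ (i + 1) j) ∧
      φ i (j + 1) = φ i j * d (gridPoint δ i j) (gridPoint δ i (j + 1)) := by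
  have hfin : (gridFill M S).Finite := finite_gridFill hM
  have hSF : S ⊆ gridFill M S := subset_gridFill fun p hp => (abs_lt.1 (hM p hp).2).2
  have hHfin : (gridH (gridFill M S)).Finite :=
    hfin.union (hfin.preimage (f := fun p : ℤ × ℤ => (p.1, p.2 - 1))
      (by rintro ⟨a, b⟩ - ⟨c, e⟩ - h; simpa using h))
  have hVfin : (gridV (gridFill M S)).Finite :=
    hfin.union (hfin.preimage (f := fun p : ℤ × ℤ => (p.1 - 1, p.2))
      (by rintro ⟨a, b⟩ - ⟨c, e⟩ - h; simpa using h))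
  have hlow : ∀ i j, (i, j) ∈ gridFill M S → j < M := by
    intro i j hij
    by_contra hj
    exact hij fun P h1 _ _ => h1 i j (not_lt.1 hj)
  obtain ⟨φ, h1, h2⟩ := exists_isGridPotential
    (fun i j => d (gridPoint δ i j) (gridPoint δ (i + 1) j))
    (fun i j => d (gridPoint δ i j) (gridPoint δ i (j + 1))) (M := M) _
    hfin.toFinset hHfin.toFinset hVfin.toFinset rfl
    (by
      rintro ⟨i, j⟩ hij
      rcases hHfin.mem_toFinset.1 hij with h | h
      · exact (hlow _ _ h).le
      · have := hlow _ _ h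
        simp only at this ⊢
        omega)
    (by
      intro i j hij
      have hsub := gridSquare_subset_of_mem_gridFill hK hδ hM hS _ (hfin.mem_toFinset.1 hij)
      have hconv := convex_gridSquare hδ i j
      rw [hd _ hconv hsub _ (gridPoint_mem_gridSquare hδ (.inl rfl) (.inl rfl)) _
          (gridPoint_mem_gridSquare hδ (.inr rfl) (.inl rfl)) _
          (gridPoint_mem_gridSquare hδ (.inr rfl) (.inr rfl)),
        hd _ hconv hsub _ (gridPoint_mem_gridSquare hδ (.inl rfl) (.inl rfl)) _
          (gridPoint_mem_gridSquare hδ (.inl rfl) (.inr rfl)) _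
          (gridPoint_mem_gridSquare hδ (.inr rfl) (.inr rfl))])
    (by
      intro i j hij
      have hij := hfin.mem_toFinset.1 hij
      simp only [Set.Finite.mem_toFinset]
      refine ⟨.inl hij, .inr ?_, .inl hij, .inr ?_⟩ <;> simpa using hij)
    (by
      intro i j hij
      simpa using gridEscapes_of_notMem_gridFill (fun h => hij (hfin.mem_toFinset.2 h)))
  refine ⟨φ, fun i j hij => ⟨h1 i j ?_, h2 i j ?_⟩⟩
  · exact hHfin.mem_toFinset.2 (.inl (hSF hij))
  · exact hVfin.mem_toFinset.2 (.inl (hSF hij))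

theorem simplyConnectedSpace_component_of_isConnected_compl {A : Set ℂ} (hA : IsOpen A)
    (hK : IsConnected (((↑) '' A : Set (OnePoint ℂ))ᶜ)) {z₀ : ℂ} (hz₀ : z₀ ∈ A) :
    SimplyConnectedSpace (connectedComponentIn A z₀) := by
  have hΩo : IsOpen (connectedComponentIn A z₀) := hA.connectedComponentIn
  have hΩA : connectedComponentIn A z₀ ⊆ A := connectedComponentIn_subset A z₀
  have hpc : PathConnectedSpace (connectedComponentIn A z₀) :=
    isPathConnected_iff_pathConnectedSpace.1
      (hΩo.isConnected_iff_isPathConnected.1 (isConnected_connectedComponentIn_iff.2 hz₀))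
  refine simply_connected_iff_loops_nullhomotopic.2 ⟨hpc, fun x γ => ?_⟩
  let ρ := PathTransport.ofPathConnected (connectedComponentIn A z₀) x
  obtain ⟨d, hρd, hd⟩ := ρ.exists_segment_cocycle
  have hR : IsCompact (Set.range fun t => (γ t : ℂ)) := isCompact_range (by fun_prop)
  obtain ⟨δ, hδ, M, hM⟩ := exists_gridSquare_subset hA hR
    (by rintro _ ⟨t, rfl⟩; exact hΩA (γ t).2)
  let S : Set (ℤ × ℤ) := {p | (gridSquare δ p.1 p.2 ∩ Set.range fun t => (γ t : ℂ)).Nonempty}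
  have hS : ∀ p ∈ S, gridSquare δ p.1 p.2 ⊆ A := fun p hp => (hM _ _ hp).2
  obtain ⟨φ, hφ⟩ := exists_gridPotential_of_isConnected_compl hK hδ
    (S := S) (fun p hp => (hM _ _ hp).1) hS hd
  have hmemS : ∀ t i j, (γ t : ℂ) ∈ gridSquare δ i j → (i, j) ∈ S :=
    fun t i j h => ⟨γ t, h, t, rfl⟩
  have hcorner : ∀ {i j k l}, (k = i ∨ k = i + 1) → (l = j ∨ l = j + 1) →
    gridPoint δ k l ∈ gridSquare δ i j := gridPoint_mem_gridSquare hδ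
  have hwd : ∀ t i j k l, (γ t : ℂ) ∈ gridSquare δ i j → (γ t : ℂ) ∈ gridSquare δ k l →
      φ i j * d (gridPoint δ i j) (γ t) = φ k l * d (gridPoint δ k l) (γ t) := by
    intro t i j k l h h'
    refine (gridSquare_induction (P := fun i j =>
      φ i j * d (gridPoint δ i j) (γ t) = φ k l * d (gridPoint δ k l) (γ t)) ?_ ?_ h h').2 rfl
    · intro i j _ h'
      have hs := hmemS t _ _ h'
      have e := (hφ _ _ hs).1
      have c := hd _ (convex_gridSquare hδ (i - 1) j) (hS _ hs) (gridPoint δ (i - 1) j)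
        (hcorner (.inl rfl) (.inl rfl)) (gridPoint δ (i - 1 + 1) j)
        (hcorner (.inr rfl) (.inl rfl)) (γ t) h'
      rw [sub_add_cancel] at e c
      rw [e, mul_assoc, c]
    · intro i j _ h'
      have hs := hmemS t _ _ h'
      have e := (hφ _ _ hs).2
      have c := hd _ (convex_gridSquare hδ i (j - 1)) (hS _ hs) (gridPoint δ i (j - 1))
        (hcorner (.inl rfl) (.inl rfl)) (gridPoint δ i (j - 1 + 1))
        (hcorner (.inl rfl) (.inr rfl)) (γ t) h'
      rw [sub_add_cancel] at e c
      rw [e, mul_assoc, c]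
  refine ρ.homotopic_refl_of_potential γ (fun w => φ ⌊(w : ℂ).re / δ⌋ ⌊(w : ℂ).im / δ⌋ *
    d (gridPoint δ ⌊(w : ℂ).re / δ⌋ ⌊(w : ℂ).im / δ⌋) w) fun t => ?_
  have hγc : Continuous fun t => (γ t : ℂ) := by fun_prop
  obtain ⟨ε, hε, hball⟩ := Metric.isOpen_iff.1 hΩo _ (γ t).2
  have hnear : ∀ᶠ t' in 𝓝 t, ∀ s ∈ Set.uIcc t t', (γ s : ℂ) ∈ Metric.ball (γ t : ℂ) ε := by
    have := hγc.continuousAt.eventually (Metric.ball_mem_nhds (γ t : ℂ) hε)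
    obtain ⟨η, hη, hsub⟩ := Metric.eventually_nhds_iff_ball.1 this
    filter_upwards [Metric.ball_mem_nhds t hη] with t' ht' s hs
    refine hsub s ?_
    rw [Metric.mem_ball, Subtype.dist_eq] at ht' ⊢
    refine lt_of_le_of_lt ?_ ht'
    rw [dist_comm, dist_comm _ (t : ℝ)]
    refine Real.dist_left_le_of_mem_uIcc ?_
    rcases Set.mem_uIcc.1 hs with h | h
    · exact Set.mem_uIcc.2 (.inl h)
    · exact Set.mem_uIcc.2 (.inr h)
  filter_upwards [hnear, hγc.continuousAt.eventually (eventually_mem_gridSquare_floor δ (γ t : ℂ))]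
    with t' h1 h2
  have hρ : ρ.toFun (γ.subpath t t') = d (γ t) (γ t') := by
    refine hρd _ (convex_ball _ _) hball _ _ _ fun s => h1 _ ?_
    rw [← Path.range_subpathAux]
    exact ⟨s, rfl⟩
  have hmem := mem_gridSquare_floor δ (γ t' : ℂ)
  rw [hρ, hwd t _ _ _ _ (mem_gridSquare_floor δ (γ t : ℂ)) h2, mul_assoc,
    hd _ (convex_gridSquare hδ _ _) (hS _ (hmemS t _ _ h2)) _ (hcorner (.inl rfl) (.inl rfl)) _ h2
      _ hmem]

/-- Let `A ⊆ ℂ` be open. Then every connected component of `A` is simply connected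
if and only if `ℂ∞ \ A` is connected, where `ℂ∞` is the Riemann sphere (the
one-point compactification of `ℂ`) and `A` is regarded as a subset of `ℂ∞` via
the canonical inclusion. -/
theorem components_simplyConnected_iff_compl_connected_onePoint (A : Set ℂ)
    (hA : IsOpen A) :
    (∀ z ∈ A, SimplyConnectedSpace (connectedComponentIn A z)) ↔
      IsConnected (((↑) '' A : Set (OnePoint ℂ))ᶜ) :=
  ⟨isConnected_compl_of_components hA,
    fun hK _ hz => simplyConnectedSpace_component_of_isConnected_compl hA hK hz⟩
end
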